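/- Let c = 1/800, let n be sufficiently large, and let p ≤ exp(c·√(n·log n)) be a prime. If for every β with n/(2p) ≤ β ≤ 2n/p one has Σ_{v ∈ (ℤ/pℤ)^n \ {0}, ρ(v) ≥ β} max_{w ∈ (ℤ/pℤ)^n} P(M_n·v = w) ≤ e^{-c·n}, then P(det(M_n) = 0) ≤ exp(-c'·√(n·log n)) with c' = 2^{-13}. -/

import Mathlib

/-- `probX μ v x` is the probability that the random walk `X_μ(v) = ε₁v₁ + ⋯ + εₙvₙ`
(valued in `ℤ/pℤ`) equals `x`, where `ε₁,…,εₙ` are i.i.d. with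
`P(εᵢ = 1) = P(εᵢ = -1) = μ/2` and `P(εᵢ = 0) = 1 - μ`. -/
noncomputable def probX {p : ℕ} [NeZero p] {ι : Type} [Fintype ι] [DecidableEq ι]
    (μ : ℝ) (v : ι → ZMod p) (x : ZMod p) : ℝ :=
  ∑ ε : ι → ({-1, 0, 1} : Finset ℤ),
    (∏ i, if (ε i : ℤ) = 0 then 1 - μ else μ / 2) *
      (if (∑ i, ((ε i : ℤ) : ZMod p) * v i) = x then 1 else 0)

/-- `rho μ v = max_x P(X_μ(v) = x)`, the largest atom of the random walk `X_μ(v)`. -/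
noncomputable def rho {p : ℕ} [NeZero p] {ι : Type} [Fintype ι] [DecidableEq ι]
    (μ : ℝ) (v : ι → ZMod p) : ℝ :=
  ⨆ x : ZMod p, probX μ v x
/-- `symPr n E` is the probability that a uniformly random `n × n` symmetric matrix
with entries in `{-1, 1}` lies in the event `E`. -/
noncomputable def symPr (n : ℕ) (E : Set (Matrix (Fin n) (Fin n) ℤ)) : ℝ :=
  (Nat.card {A : Matrix (Fin n) (Fin n) ℤ |
      (A.IsSymm ∧ ∀ i j, A i j = 1 ∨ A i j = -1) ∧ A ∈ E} : ℝ) /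
  (Nat.card {A : Matrix (Fin n) (Fin n) ℤ |
      A.IsSymm ∧ ∀ i j, A i j = 1 ∨ A i j = -1} : ℝ)

namespace SymmetricSign

open Finset
open scoped BigOperators Pointwise Matrix

section Characters

variable {p : ℕ} [Fact p.Prime]

/-- The real part of the standard additive character of `ℤ/pℤ`, i.e. `x ↦ cos (2πx/p)`. -/
noncomputable def cosChar (x : ZMod p) : ℝ := (ZMod.stdAddChar x).re

lemma cosChar_zero : cosChar (0 : ZMod p) = 1 := by simp [cosChar]

lemma cosChar_neg (x : ZMod p) : cosChar (-x) = cosChar x := by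
  simp [cosChar, AddChar.map_neg_eq_conj]

lemma re_sq_add_im_sq_stdAddChar (x : ZMod p) :
    (ZMod.stdAddChar x).re ^ 2 + (ZMod.stdAddChar x).im ^ 2 = 1 := by
  have h := AddChar.norm_apply (ZMod.stdAddChar (N := p)) x
  have h2 := Complex.sq_norm (ZMod.stdAddChar x)
  rw [h, Complex.normSq_apply] at h2
  linarith

lemma abs_cosChar_le_one (x : ZMod p) : |cosChar x| ≤ 1 := by
  rw [← sq_le_one_iff_abs_le_one]
  have := re_sq_add_im_sq_stdAddChar x
  unfold cosChar
  nlinarith [sq_nonneg (ZMod.stdAddChar x).im]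

lemma cosChar_le_one (x : ZMod p) : cosChar x ≤ 1 := (abs_le.1 (abs_cosChar_le_one x)).2

lemma neg_one_le_cosChar (x : ZMod p) : -1 ≤ cosChar x := (abs_le.1 (abs_cosChar_le_one x)).1

lemma cosChar_add_add_cosChar_sub (x y : ZMod p) :
    cosChar (x + y) + cosChar (x - y) = 2 * cosChar x * cosChar y := by
  simp only [cosChar, sub_eq_add_neg, AddChar.map_add_eq_mul, AddChar.map_neg_eq_conj,
    Complex.mul_re, Complex.conj_re, Complex.conj_im]
  ring

lemma cosChar_two_mul (x : ZMod p) : cosChar (2 * x) = 2 * cosChar x ^ 2 - 1 := by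
  have h := cosChar_add_add_cosChar_sub x x
  rw [sub_self, cosChar_zero, ← two_mul] at h
  linarith

lemma one_sub_cosChar_add_le (x y : ZMod p) :
    1 - cosChar (x + y) ≤ 2 * (1 - cosChar x) + 2 * (1 - cosChar y) := by
  have hx := re_sq_add_im_sq_stdAddChar x
  have hy := re_sq_add_im_sq_stdAddChar y
  simp only [cosChar, AddChar.map_add_eq_mul, Complex.mul_re]
  set a := (ZMod.stdAddChar x).re
  set b := (ZMod.stdAddChar x).im
  set c := (ZMod.stdAddChar y).re
  set d := (ZMod.stdAddChar y).im
  nlinarith [sq_nonneg (1 - a - (1 - c)), sq_nonneg (b + d), sq_nonneg (b - d),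
    sq_nonneg (a + c - 2), sq_nonneg (a - c)]

lemma sum_cosChar_mul (x : ZMod p) :
    ∑ ξ : ZMod p, cosChar (x * ξ) = if x = 0 then (p : ℝ) else 0 := by
  have h := AddChar.sum_mulShift x (ZMod.isPrimitive_stdAddChar p)
  have h2 := congrArg Complex.re h
  rw [Complex.re_sum] at h2
  simp only [cosChar, mul_comm x]
  rw [h2, ZMod.card]
  split_ifs <;> simp

lemma cosChar_units_mul (ε : ℤˣ) (x : ZMod p) :
    cosChar (((ε : ℤ) : ZMod p) * x) = cosChar x := by
  rcases Int.units_eq_one_or ε with rfl | rfl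
  · simp
  · simp [cosChar_neg]

end Characters

section LazyWalk

variable {p : ℕ} [Fact p.Prime] {ι : Type*}

/-- The characteristic function of the lazy walk `∑_{j ∈ T} η_j v_j`, where the `η_j` are
independent, `0` with probability `3/4` and `±1` with probability `1/8` each. -/
noncomputable def walkChar (v : ι → ZMod p) (T : Finset ι) (ξ : ZMod p) : ℝ :=
  ∏ j ∈ T, (3 / 4 + cosChar (v j * ξ) / 4)

/-- The probability that the lazy walk `∑_{j ∈ T} η_j v_j` equals `x`. -/
noncomputable def walkProb (v : ι → ZMod p) (T : Finset ι) (x : ZMod p) : ℝ :=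
  (∑ ξ : ZMod p, walkChar v T ξ * cosChar (x * ξ)) / p

/-- The probability that the lazy walk `∑_{j ∈ T} η_j v_j` returns to `0`. -/
noncomputable def returnProb (v : ι → ZMod p) (T : Finset ι) : ℝ :=
  (∑ ξ : ZMod p, walkChar v T ξ) / p

lemma prime_cast_pos : (0 : ℝ) < p := by exact_mod_cast (Fact.out : p.Prime).pos

lemma walkProb_zero (v : ι → ZMod p) (T : Finset ι) : walkProb v T 0 = returnProb v T := by
  simp [walkProb, returnProb, cosChar_zero]

lemma half_le_walkFactor (x : ZMod p) : 1 / 2 ≤ 3 / 4 + cosChar x / 4 := by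
  linarith [neg_one_le_cosChar x]

lemma walkFactor_le_one (x : ZMod p) : 3 / 4 + cosChar x / 4 ≤ 1 := by
  linarith [cosChar_le_one x]

lemma walkChar_pos (v : ι → ZMod p) (T : Finset ι) (ξ : ZMod p) : 0 < walkChar v T ξ :=
  prod_pos fun j _ => by linarith [half_le_walkFactor (v j * ξ)]

lemma walkChar_le_one (v : ι → ZMod p) (T : Finset ι) (ξ : ZMod p) : walkChar v T ξ ≤ 1 :=
  prod_le_one (fun j _ => by linarith [half_le_walkFactor (v j * ξ)])
    fun j _ => walkFactor_le_one _

lemma walkChar_zero (v : ι → ZMod p) (T : Finset ι) : walkChar v T 0 = 1 := by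
  simp [walkChar, cosChar_zero]; norm_num

lemma walkChar_congr {v w : ι → ZMod p} {T : Finset ι} (h : ∀ j ∈ T, v j = w j) :
    walkChar v T = walkChar w T := by
  ext ξ
  exact prod_congr rfl fun j hj => by rw [h j hj]

lemma returnProb_congr {v w : ι → ZMod p} {T : Finset ι} (h : ∀ j ∈ T, v j = w j) :
    returnProb v T = returnProb w T := by
  simp [returnProb, walkChar_congr h]

lemma walkProb_congr {v w : ι → ZMod p} {T : Finset ι} (h : ∀ j ∈ T, v j = w j) :
    walkProb v T = walkProb w T := by
  ext x
  simp [walkProb, walkChar_congr h]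

lemma inv_prime_le_returnProb (v : ι → ZMod p) (T : Finset ι) : 1 / (p : ℝ) ≤ returnProb v T := by
  unfold returnProb
  gcongr
  calc (1 : ℝ) = walkChar v T 0 := (walkChar_zero v T).symm
    _ ≤ _ := single_le_sum (fun ξ _ => (walkChar_pos v T ξ).le) (mem_univ 0)

lemma returnProb_pos (v : ι → ZMod p) (T : Finset ι) : 0 < returnProb v T :=
  lt_of_lt_of_le (by have := prime_cast_pos (p := p); positivity) (inv_prime_le_returnProb v T)

lemma returnProb_empty (v : ι → ZMod p) : returnProb v ∅ = 1 := by
  have := prime_cast_pos (p := p)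
  simp [returnProb, walkChar, ZMod.card, this.ne']

lemma walkProb_empty (v : ι → ZMod p) (x : ZMod p) :
    walkProb v ∅ x = if x = 0 then 1 else 0 := by
  have := prime_cast_pos (p := p)
  simp only [walkProb, walkChar, prod_empty, one_mul, sum_cosChar_mul]
  split_ifs <;> simp [this.ne']

/-- The points which the lazy walk visits at least half as often as the origin. -/
noncomputable def heavyPoints (v : ι → ZMod p) (T : Finset ι) : Finset (ZMod p) :=
  {x | returnProb v T / 2 < walkProb v T x}

lemma mem_heavyPoints {v : ι → ZMod p} {T : Finset ι} {x : ZMod p} :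
    x ∈ heavyPoints v T ↔ returnProb v T / 2 < walkProb v T x := by
  simp [heavyPoints]

lemma heavyPoints_congr {v w : ι → ZMod p} {T : Finset ι} (h : ∀ j ∈ T, v j = w j) :
    heavyPoints v T = heavyPoints w T := by
  simp [heavyPoints, returnProb_congr h, walkProb_congr h]

lemma zero_mem_heavyPoints (v : ι → ZMod p) (T : Finset ι) : 0 ∈ heavyPoints v T := by
  rw [mem_heavyPoints, walkProb_zero]
  linarith [returnProb_pos v T]

lemma eq_zero_of_mem_heavyPoints_empty {v : ι → ZMod p} {x : ZMod p}
    (hx : x ∈ heavyPoints v ∅) : x = 0 := by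
  by_contra h
  rw [mem_heavyPoints, walkProb_empty, if_neg h, returnProb_empty] at hx
  norm_num at hx

variable [DecidableEq ι]

lemma walkChar_union {S T : Finset ι} (v : ι → ZMod p) (h : Disjoint S T) (ξ : ZMod p) :
    walkChar v (S ∪ T) ξ = walkChar v S ξ * walkChar v T ξ := prod_union h

lemma returnProb_anti {S T : Finset ι} (v : ι → ZMod p) (h : S ⊆ T) :
    returnProb v T ≤ returnProb v S := by
  unfold returnProb
  gcongr with ξ
  rw [← union_sdiff_of_subset h, walkChar_union v disjoint_sdiff]
  exact mul_le_of_le_one_right (walkChar_pos _ _ _).le (walkChar_le_one _ _ _)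

lemma returnProb_le_two_pow_mul_union {S T : Finset ι} (v : ι → ZMod p) (h : Disjoint S T) :
    returnProb v T ≤ 2 ^ #S * returnProb v (S ∪ T) := by
  unfold returnProb
  rw [← mul_div_assoc, mul_sum]
  gcongr with ξ
  rw [walkChar_union v h, ← mul_assoc]
  refine le_mul_of_one_le_left (walkChar_pos _ _ _).le ?_
  calc (1 : ℝ) = 2 ^ #S * ∏ _j ∈ S, (1 / 2 : ℝ) := by
        rw [prod_const, ← mul_pow]; norm_num
    _ ≤ 2 ^ #S * walkChar v S ξ := by
        gcongr
        exact prod_le_prod (fun _ _ => by norm_num) fun j _ => half_le_walkFactor _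

lemma walkProb_insert {T : Finset ι} {j : ι} (v : ι → ZMod p) (hj : j ∉ T) (x : ZMod p) :
    walkProb v (insert j T) x =
      3 / 4 * walkProb v T x + (walkProb v T (x + v j) + walkProb v T (x - v j)) / 8 := by
  have key : ∑ ξ, walkChar v (insert j T) ξ * cosChar (x * ξ) =
      3 / 4 * ∑ ξ, walkChar v T ξ * cosChar (x * ξ) +
        (∑ ξ, walkChar v T ξ * cosChar ((x + v j) * ξ) +
          ∑ ξ, walkChar v T ξ * cosChar ((x - v j) * ξ)) / 8 := by
    rw [← sum_add_distrib, sum_div, mul_sum, ← sum_add_distrib]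
    refine sum_congr rfl fun ξ _ => ?_
    have h := cosChar_add_add_cosChar_sub (x * ξ) (v j * ξ)
    rw [← add_mul, ← sub_mul] at h
    rw [← mul_add, h, walkChar, prod_insert hj, ← walkChar]
    ring
  simp only [walkProb, key]
  ring

lemma walkProb_nonneg (v : ι → ZMod p) (T : Finset ι) (x : ZMod p) : 0 ≤ walkProb v T x := by
  induction T using Finset.induction_on generalizing x with
  | empty => rw [walkProb_empty]; split_ifs <;> norm_num
  | insert j T hj ih =>
    rw [walkProb_insert v hj]
    linarith [ih x, ih (x + v j), ih (x - v j)]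

lemma sum_walkProb (v : ι → ZMod p) (T : Finset ι) : ∑ x, walkProb v T x = 1 := by
  induction T using Finset.induction_on with
  | empty => simp [walkProb_empty]
  | insert j T hj ih =>
    simp only [walkProb_insert v hj, sum_add_distrib, ← mul_sum, ← sum_div]
    have h1 : ∑ x, walkProb v T (x + v j) = 1 :=
      (Fintype.sum_equiv (Equiv.addRight (v j)) _ _ fun _ => rfl).trans ih
    have h2 : ∑ x, walkProb v T (x - v j) = 1 :=
      (Fintype.sum_equiv (Equiv.subRight (v j)) _ _ fun _ => rfl).trans ih
    rw [ih, h1, h2]; norm_num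

lemma returnProb_insert {T : Finset ι} {j : ι} (v : ι → ZMod p) (hj : j ∉ T) :
    returnProb v (insert j T) = 3 / 4 * returnProb v T + walkProb v T (v j) / 4 := by
  rw [← walkProb_zero, walkProb_insert v hj, zero_add, zero_sub, walkProb_zero]
  have : walkProb v T (-v j) = walkProb v T (v j) := by
    simp [walkProb, neg_mul, cosChar_neg]
  rw [this]; ring

lemma returnProb_mul_card_heavyPoints_le (v : ι → ZMod p) (T : Finset ι) :
    returnProb v T * #(heavyPoints v T) ≤ 2 := by
  have h : ∑ _x ∈ heavyPoints v T, returnProb v T / 2 ≤ 1 := by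
    rw [← sum_walkProb v T]
    refine (sum_le_sum fun x hx => (mem_heavyPoints.1 hx).le).trans ?_
    exact sum_le_sum_of_subset_of_nonneg (subset_univ _) fun x _ _ => walkProb_nonneg v T x
  rw [sum_const, nsmul_eq_mul] at h
  linarith

/-- Every set of coordinates contains a short, quickly mixing part `T` for which all remaining
coordinates are heavy points. -/
lemma exists_saturated_subset (v : ι → ZMod p) (S : Finset ι) :
    ∃ T ⊆ S, returnProb v T ≤ (7 / 8) ^ #T ∧ (∀ j ∈ T, v j ≠ 0) ∧
      ∀ j ∈ S \ T, v j ∈ heavyPoints v T := by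
  classical
  let F : Finset (Finset ι) :=
    {T ∈ S.powerset | returnProb v T ≤ (7 / 8) ^ #T ∧ ∀ j ∈ T, v j ≠ 0}
  have hF : F.Nonempty := ⟨∅, by simp [F, returnProb_empty]⟩
  obtain ⟨T, hT, hmax⟩ := exists_max_image F card hF
  simp only [F, mem_filter, mem_powerset] at hT hmax
  refine ⟨T, hT.1, hT.2.1, hT.2.2, fun j hj => ?_⟩
  rw [mem_sdiff] at hj
  by_contra hN
  have hj0 : v j ≠ 0 := fun h => hN (h ▸ zero_mem_heavyPoints v T)
  rw [mem_heavyPoints, not_lt] at hN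
  have := hmax (insert j T) ⟨insert_subset hj.1 hT.1, ?_, ?_⟩
  · rw [card_insert_of_notMem hj.2] at this
    omega
  · rw [card_insert_of_notMem hj.2, returnProb_insert v hj.2, pow_succ]
    linarith [hT.2.1]
  · intro i hi
    rcases mem_insert.1 hi with rfl | hi
    · exact hj0
    · exact hT.2.2 i hi

end LazyWalk

section Halasz

variable {p : ℕ} [Fact p.Prime] {ι : Type*}

/-- The total phase `∑_{j ∈ T} (1 - cos (2πv_jξ/p))`. -/
noncomputable def phase (v : ι → ZMod p) (T : Finset ι) (ξ : ZMod p) : ℝ :=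
  ∑ j ∈ T, (1 - cosChar (v j * ξ))

lemma phase_zero (v : ι → ZMod p) (T : Finset ι) : phase v T 0 = 0 := by
  simp [phase, cosChar_zero]

lemma phase_add_le (v : ι → ZMod p) (T : Finset ι) (ξ η : ZMod p) :
    phase v T (ξ + η) ≤ 2 * phase v T ξ + 2 * phase v T η := by
  simp only [phase, mul_sum, ← sum_add_distrib]
  exact sum_le_sum fun j _ => by rw [mul_add]; exact one_sub_cosChar_add_le _ _

lemma walkChar_le_exp_phase (v : ι → ZMod p) (T : Finset ι) (ξ : ZMod p) :
    walkChar v T ξ ≤ Real.exp (-(phase v T ξ / 4)) := by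
  rw [phase, sum_div, ← sum_neg_distrib, Real.exp_sum]
  refine prod_le_prod (fun j _ => by linarith [half_le_walkFactor (v j * ξ)]) fun j _ => ?_
  linarith [Real.add_one_le_exp (-((1 - cosChar (v j * ξ)) / 4))]

lemma exp_phase_le_walkChar (v : ι → ZMod p) (T : Finset ι) (ξ : ZMod p) :
    Real.exp (-(phase v T ξ / 2)) ≤ walkChar v T ξ := by
  rw [phase, sum_div, ← sum_neg_distrib, Real.exp_sum]
  refine prod_le_prod (fun j _ => (Real.exp_pos _).le) fun j _ => ?_
  have h1 := neg_one_le_cosChar (v j * ξ)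
  have h2 := cosChar_le_one (v j * ξ)
  set c := cosChar (v j * ξ)
  rw [Real.exp_neg]
  have h3 := Real.add_one_le_exp ((1 - c) / 2)
  refine inv_le_of_inv_le₀ (by linarith) (le_trans ?_ h3)
  rw [inv_le_iff_one_le_mul₀ (by linarith)]
  nlinarith

/-- The frequencies at which the total phase is at most `s`. -/
noncomputable def phaseLevel (v : ι → ZMod p) (T : Finset ι) (s : ℝ) : Finset (ZMod p) :=
  {ξ | phase v T ξ ≤ s}

lemma mem_phaseLevel {v : ι → ZMod p} {T : Finset ι} {s : ℝ} {ξ : ZMod p} :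
    ξ ∈ phaseLevel v T s ↔ phase v T ξ ≤ s := by
  simp [phaseLevel]

lemma two_pow_mul_card_phaseLevel_le (v : ι → ZMod p) (T : Finset ι) (r : ℕ) {s : ℝ} (hs : 0 ≤ s)
    (h : phaseLevel v T s ≠ univ) :
    2 ^ r * ((#(phaseLevel v T (s / 4 ^ r)) : ℝ) - 1) ≤ #(phaseLevel v T s) - 1 := by
  induction r generalizing s with
  | zero => simp
  | succ r ih =>
    have hne : (phaseLevel v T (s / 4)).Nonempty :=
      ⟨0, mem_phaseLevel.2 (by rw [phase_zero]; positivity)⟩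
    have hsub : phaseLevel v T (s / 4) ⊆ phaseLevel v T s := fun ξ hξ => by
      rw [mem_phaseLevel] at *
      linarith
    have hadd : phaseLevel v T (s / 4) + phaseLevel v T (s / 4) ⊆ phaseLevel v T s := by
      intro ξ hξ
      obtain ⟨a, ha, b, hb, rfl⟩ := mem_add.1 hξ
      rw [mem_phaseLevel] at *
      linarith [phase_add_le v T a b]
    have hlt : #(phaseLevel v T s) < p := by
      have := card_lt_univ_of_notMem (s := phaseLevel v T s)
        (x := (not_forall.1 fun hall => h (eq_univ_iff_forall.2 hall)).choose)
        (not_forall.1 fun hall => h (eq_univ_iff_forall.2 hall)).choose_spec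
      rwa [ZMod.card] at this
    have hcd := (ZMod.cauchy_davenport (Fact.out : p.Prime) hne hne).trans (card_le_card hadd)
    have hpos := hne.card_pos
    have hstep : 2 * #(phaseLevel v T (s / 4)) ≤ #(phaseLevel v T s) + 1 := by
      rcases min_le_iff.1 hcd with h1 | h1 <;> omega
    have hstep' : 2 * (#(phaseLevel v T (s / 4)) : ℝ) ≤ #(phaseLevel v T s) + 1 := by
      exact_mod_cast hstep
    have := ih (s := s / 4) (by positivity) fun hu => h (univ_subset_iff.1 (hu ▸ hsub))
    rw [div_div, ← pow_succ'] at this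
    rw [pow_succ']
    linarith

lemma exists_one_le_phase {v : ι → ZMod p} {T : Finset ι} (hT : T.Nonempty)
    (hv : ∀ j ∈ T, v j ≠ 0) : ∃ ξ, 1 ≤ phase v T ξ := by
  by_contra! h
  have h1 : ∑ ξ, phase v T ξ < ∑ _ξ : ZMod p, (1 : ℝ) :=
    sum_lt_sum_of_nonempty univ_nonempty fun ξ _ => h ξ
  have h2 : ∑ ξ, phase v T ξ = #T * p := by
    simp only [phase]
    rw [sum_comm, sum_congr rfl (g := fun _ => (p : ℝ)), sum_const, nsmul_eq_mul]
    intro j hj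
    rw [sum_sub_distrib, sum_cosChar_mul, if_neg (hv j hj)]
    simp [ZMod.card]
  have h3 : (1 : ℝ) ≤ #T := by exact_mod_cast hT.card_pos
  rw [h2] at h1
  simp only [sum_const, card_univ, ZMod.card, nsmul_eq_mul, mul_one] at h1
  nlinarith [prime_cast_pos (p := p)]

lemma sum_walkChar_pow_le {v : ι → ZMod p} {T : Finset ι} (hT : T.Nonempty)
    (hv : ∀ j ∈ T, v j ≠ 0) (r : ℕ) :
    ∑ ξ, walkChar v T ξ ^ (8 ^ r + 1) ≤ 1 + 10 / 2 ^ r * ∑ ξ, walkChar v T ξ := by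
  set W := ∑ ξ, walkChar v T ξ
  have hne : phaseLevel v T (1 / 2) ≠ univ := by
    obtain ⟨ξ, hξ⟩ := exists_one_le_phase hT hv
    intro h
    have := mem_phaseLevel.1 (h ▸ mem_univ ξ)
    linarith
  have hhalf : (#(phaseLevel v T (1 / 2)) : ℝ) ≤ 2 * W := by
    have h1 : ∑ _ξ ∈ phaseLevel v T (1 / 2), (1 / 2 : ℝ) ≤ W := by
      refine (sum_le_sum fun ξ hξ => ?_).trans (sum_le_sum_of_subset_of_nonneg (subset_univ _)
        fun ξ _ _ => (walkChar_pos v T ξ).le)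
      refine le_trans ?_ (exp_phase_le_walkChar v T ξ)
      have h2 := Real.add_one_le_exp (-(phase v T ξ / 2))
      have h3 := mem_phaseLevel.1 hξ
      linarith
    rw [sum_const, nsmul_eq_mul] at h1
    linarith
  have hlevel := two_pow_mul_card_phaseLevel_le v T r (by norm_num) hne
  set A := phaseLevel v T (1 / 2 / 4 ^ r)
  have h2r : (0 : ℝ) < 2 ^ r := by positivity
  have hA : (#A : ℝ) ≤ 1 + 2 / 2 ^ r * W := by
    rw [div_mul_eq_mul_div, ← sub_le_iff_le_add', le_div_iff₀ h2r]
    linarith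
  have hpt : ∀ ξ, walkChar v T ξ ^ (8 ^ r + 1) ≤
      (if ξ ∈ A then 1 else 0) + 8 / 2 ^ r * walkChar v T ξ := by
    intro ξ
    have hpos := walkChar_pos v T ξ
    split_ifs with hξ
    · have : walkChar v T ξ ^ (8 ^ r + 1) ≤ 1 := pow_le_one₀ hpos.le (walkChar_le_one _ _ _)
      have h0 : 0 ≤ 8 / 2 ^ r * walkChar v T ξ := by positivity
      linarith
    · rw [pow_succ, zero_add]
      gcongr
      have hph : 1 / 2 / 4 ^ r < phase v T ξ := not_le.1 fun h => hξ (mem_phaseLevel.2 h)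
      calc walkChar v T ξ ^ 8 ^ r ≤ Real.exp (-(phase v T ξ / 4)) ^ 8 ^ r := by
            gcongr; exact walkChar_le_exp_phase v T ξ
        _ = Real.exp (-(8 ^ r * phase v T ξ / 4)) := by
            rw [← Real.exp_nat_mul]; congr 1; push_cast; ring
        _ ≤ Real.exp (-(2 ^ r / 8)) := by
            rw [Real.exp_le_exp, neg_le_neg_iff]
            calc (2 : ℝ) ^ r / 8 = 8 ^ r * (1 / 2 / 4 ^ r) / 4 := by
                  rw [show (8 : ℝ) = 2 * 4 by norm_num, mul_pow]
                  field_simp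
              _ ≤ _ := by gcongr
        _ ≤ 8 / 2 ^ r := by
            rw [Real.exp_neg]
            refine inv_le_of_inv_le₀ (by positivity) ?_
            rw [inv_div]
            linarith [Real.add_one_le_exp ((2 : ℝ) ^ r / 8)]
  calc _ ≤ ∑ ξ, ((if ξ ∈ A then 1 else 0) + 8 / 2 ^ r * walkChar v T ξ) :=
        sum_le_sum fun ξ _ => hpt ξ
    _ = #A + 8 / 2 ^ r * W := by
        rw [sum_add_distrib, ← mul_sum]; simp [W]
    _ ≤ 1 + 2 / 2 ^ r * W + 8 / 2 ^ r * W := by gcongr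
    _ = _ := by ring

lemma prod_range_le_sum_pow {k : ℕ} (hk : k ≠ 0) {f : ℕ → ℝ} (hf : ∀ i, 0 ≤ f i) :
    ∏ i ∈ range k, f i ≤ (∑ i ∈ range k, f i ^ k) / k := by
  have h := Real.geom_mean_le_arith_mean_weighted (range k) (fun _ => (k : ℝ)⁻¹)
    (fun i => f i ^ k) (fun _ _ => by positivity) (by simp [hk]) fun i _ => pow_nonneg (hf i) k
  rw [← mul_sum, inv_mul_eq_div] at h
  refine le_trans (le_of_eq (prod_congr rfl fun i _ => ?_)) h
  rw [Real.pow_rpow_inv_natCast (hf i) hk]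

/-- A Halász-type bound: the return probability of a union of many walks gains over that
of one of the parts. -/
lemma exists_returnProb_le (v : ι → ZMod p) (r : ℕ) {T : ℕ → Finset ι} {U : Finset ι}
    (hT : ∀ i < 8 ^ r + 1, (T i).Nonempty) (hv : ∀ i < 8 ^ r + 1, ∀ j ∈ T i, v j ≠ 0)
    (hU : ∀ ξ, walkChar v U ξ = ∏ i ∈ range (8 ^ r + 1), walkChar v (T i) ξ) :
    ∃ i < 8 ^ r + 1, returnProb v U ≤ 1 / p + 10 / 2 ^ r * returnProb v (T i) := by
  set k := 8 ^ r + 1 with hk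
  obtain ⟨i, hi, hmax⟩ := exists_max_image (range k) (fun i => returnProb v (T i))
    ⟨0, by simp [hk]⟩
  refine ⟨i, mem_range.1 hi, ?_⟩
  have hp := prime_cast_pos (p := p)
  have hk0 : (0 : ℝ) < k := by rw [hk]; positivity
  have hsum : ∀ j, ∑ ξ, walkChar v (T j) ξ = p * returnProb v (T j) := fun j => by
    rw [returnProb]; field_simp
  have : ∑ ξ, walkChar v U ξ ≤ 1 + 10 / 2 ^ r * (p * returnProb v (T i)) := by
    calc ∑ ξ, walkChar v U ξ
        ≤ ∑ ξ, (∑ j ∈ range k, walkChar v (T j) ξ ^ k) / k := by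
          refine sum_le_sum fun ξ _ => ?_
          rw [hU]
          exact prod_range_le_sum_pow (Nat.succ_ne_zero _) fun j => (walkChar_pos v (T j) ξ).le
      _ = (∑ j ∈ range k, ∑ ξ, walkChar v (T j) ξ ^ k) / k := by
          rw [← sum_div, sum_comm]
      _ ≤ (∑ _j ∈ range k, (1 + 10 / 2 ^ r * (p * returnProb v (T i)))) / k := by
          gcongr with j hj
          have hj' := mem_range.1 hj
          refine (sum_walkChar_pow_le (hT j hj') (hv j hj') r).trans ?_
          rw [hsum]
          gcongr
          exact hmax j hj
      _ = _ := by rw [sum_const, card_range, nsmul_eq_mul]; field_simp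
  rw [returnProb, div_le_iff₀ hp]
  refine this.trans (le_of_eq ?_)
  field_simp

variable [DecidableEq ι]

/-- Every vector is determined by a short part `T`, coordinates in the heavy points of `T`, and,
outside a small set `U`, either zeros or coordinates in the heavy points of some `S ⊆ U` whose
return probability is much larger than that of `U`. -/
lemma exists_decomposition (v : ι → ZMod p) [Fintype ι] (r : ℕ) {D : ℕ}
    (hD : ∀ T, returnProb v T ≤ (7 / 8) ^ #T → #T ≤ D) :
    ∃ T U, T ⊆ U ∧ #U ≤ (8 ^ r + 1) * D ∧ returnProb v T ≤ (7 / 8) ^ #T ∧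
      (∀ j ∉ T, v j ∈ heavyPoints v T) ∧
      ((∀ j ∉ U, v j = 0) ∨ ∃ S ⊆ U, (∀ j ∉ U, v j ∈ heavyPoints v S) ∧
        returnProb v U ≤ 1 / p + 10 / 2 ^ r * returnProb v S) := by
  choose t ht hret hne hheavy using exists_saturated_subset v
  let U : ℕ → Finset ι := fun i => Nat.rec ∅ (fun _ W => W ∪ t Wᶜ) i
  let T : ℕ → Finset ι := fun i => t (U i)ᶜ
  have hU0 : U 0 = ∅ := rfl
  have hU : ∀ i, U (i + 1) = U i ∪ T i := fun i => rfl
  have hdisj : ∀ i, Disjoint (U i) (T i) := fun i =>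
    disjoint_left.2 fun j hj hj' => (mem_compl.1 (ht _ hj')) hj
  have hmono : Monotone U := monotone_nat_of_le_succ fun i => by rw [hU]; exact subset_union_left
  have hTU : ∀ i, T i ⊆ U (i + 1) := fun i => by rw [hU]; exact subset_union_right
  have hcard : ∀ i, #(U i) ≤ i * D := by
    intro i
    induction i with
    | zero => simp [hU0]
    | succ i ih =>
      rw [hU, add_mul, one_mul]
      exact (card_union_le _ _).trans (add_le_add ih (hD _ (hret _)))
  have hprod : ∀ i ξ, walkChar v (U i) ξ = ∏ j ∈ range i, walkChar v (T j) ξ := by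
    intro i ξ
    induction i with
    | zero => simp [hU0, walkChar]
    | succ i ih => rw [hU, walkChar_union v (hdisj i), ih, prod_range_succ]
  have hout : ∀ i, ∀ j ∉ U (i + 1), v j ∈ heavyPoints v (T i) := by
    intro i j hj
    rw [hU, mem_union, not_or] at hj
    exact hheavy _ j (mem_sdiff.2 ⟨mem_compl.2 hj.1, hj.2⟩)
  set k := 8 ^ r + 1 with hk
  refine ⟨T 0, U k, (hTU 0).trans (hmono (Nat.le_add_left 1 _)), hcard k, hret _,
    fun j hj => ?_, ?_⟩
  · exact hheavy _ j (mem_sdiff.2 ⟨by simp [hU0], hj⟩)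
  by_cases hall : ∀ i < k, (T i).Nonempty
  · right
    obtain ⟨i, hi, hle⟩ := exists_returnProb_le v r hall (fun i _ => hne _) (hprod k)
    have hsub : U (i + 1) ⊆ U k := hmono hi
    exact ⟨T i, (hTU i).trans hsub, fun j hj => hout i j fun h => hj (hsub h), hle⟩
  · left
    push Not at hall
    obtain ⟨i, hi, hTi⟩ := hall
    intro j hj
    have := hout i j fun h => hj (hmono hi h)
    rw [hTi] at this
    exact eq_zero_of_mem_heavyPoints_empty this

end Halasz

section Indicator

open scoped Classical in
/-- The real-valued indicator of a proposition. -/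
noncomputable def ind (P : Prop) : ℝ := if P then 1 else 0

lemma ind_nonneg (P : Prop) : 0 ≤ ind P := by unfold ind; split_ifs <;> norm_num

lemma ind_le_one (P : Prop) : ind P ≤ 1 := by unfold ind; split_ifs <;> norm_num

lemma ind_of_true {P : Prop} (h : P) : ind P = 1 := if_pos h

lemma ind_of_false {P : Prop} (h : ¬P) : ind P = 0 := if_neg h

lemma ind_and (P Q : Prop) : ind (P ∧ Q) = ind P * ind Q := by
  by_cases hP : P <;> by_cases hQ : Q <;> simp [ind, hP, hQ]

lemma ind_mono {P Q : Prop} (h : P → Q) : ind P ≤ ind Q := by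
  by_cases hP : P
  · rw [ind_of_true hP, ind_of_true (h hP)]
  · rw [ind_of_false hP]; exact ind_nonneg Q

lemma ind_or_le (P Q : Prop) : ind (P ∨ Q) ≤ ind P + ind Q := by
  by_cases hP : P <;> by_cases hQ : Q <;> simp [ind, hP, hQ]

lemma expect_comp_mul_left {G : Type*} [Fintype G] [Group G] (g : G) (H : G → ℝ) :
    𝔼 x, H (g * x) = 𝔼 x, H x :=
  Fintype.expect_equiv (Equiv.mulLeft g) _ _ fun _ => rfl

lemma expect_mono {Ω : Type*} [Fintype Ω] {F G : Ω → ℝ} (h : ∀ ω, F ω ≤ G ω) :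
    𝔼 ω, F ω ≤ 𝔼 ω, G ω :=
  expect_le_expect fun ω _ => h ω

end Indicator

section SmallBall

variable {p : ℕ} [Fact p.Prime] {ι : Type*}

lemma two_ne_zero_of_ne_two (hp : p ≠ 2) : (2 : ZMod p) ≠ 0 := fun h => by
  rw [show (2 : ZMod p) = ((2 : ℕ) : ZMod p) by norm_num, ZMod.natCast_eq_zero_iff] at h
  exact hp ((Nat.prime_dvd_prime_iff_eq Fact.out Nat.prime_two).1 h)

lemma sum_prod_abs_cosChar_le (hp : p ≠ 2) (y : ι → ZMod p) (C : Finset ι) :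
    ∑ ξ, ∏ j ∈ C, |cosChar (y j * ξ)| ≤ ∑ ξ, walkChar y C ξ := by
  have h2 := two_ne_zero_of_ne_two hp
  calc ∑ ξ, ∏ j ∈ C, |cosChar (y j * ξ)| ≤ ∑ ξ, walkChar y C (2 * ξ) := by
        refine sum_le_sum fun ξ _ => prod_le_prod (fun _ _ => abs_nonneg _) fun j _ => ?_
        rw [mul_left_comm, cosChar_two_mul, ← sq_abs]
        nlinarith [sq_nonneg (|cosChar (y j * ξ)| - 1)]
    _ = _ := Fintype.sum_equiv (Equiv.mulLeft₀ 2 h2) _ _ fun _ => rfl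

variable [Fintype ι] [DecidableEq ι]

lemma expect_cosChar_signed_sum (y : ι → ZMod p) (C : Finset ι) (x ξ : ZMod p) :
    𝔼 ε : ι → ℤˣ, cosChar ((∑ j ∈ C, ((ε j : ℤ) : ZMod p) * y j + x) * ξ) =
      cosChar (x * ξ) * ∏ j ∈ C, cosChar (y j * ξ) := by
  induction C using Finset.induction_on with
  | empty => simp
  | insert i C hi ih =>
    set H : (ι → ℤˣ) → ℝ := fun ε =>
      cosChar ((∑ j ∈ insert i C, ((ε j : ℤ) : ZMod p) * y j + x) * ξ)
    set g : ι → ℤˣ := Pi.mulSingle i (-1)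
    have hsym : 𝔼 ε, H ε = 𝔼 ε, (H ε + H (g * ε)) / 2 := by
      rw [← expect_div, expect_add_distrib, expect_comp_mul_left]; ring
    have hpt : ∀ ε, (H ε + H (g * ε)) / 2 =
        cosChar ((∑ j ∈ C, ((ε j : ℤ) : ZMod p) * y j + x) * ξ) * cosChar (y i * ξ) := by
      intro ε
      have hC : ∑ j ∈ C, (((g * ε) j : ℤ) : ZMod p) * y j = ∑ j ∈ C, ((ε j : ℤ) : ZMod p) * y j :=
        sum_congr rfl fun j hj => by
          have : j ≠ i := fun h => hi (h ▸ hj)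
          simp [g, Pi.mulSingle_eq_of_ne this]
      have h := cosChar_add_add_cosChar_sub ((∑ j ∈ C, ((ε j : ℤ) : ZMod p) * y j + x) * ξ)
        (((ε i : ℤ) : ZMod p) * (y i * ξ))
      rw [cosChar_units_mul] at h
      simp only [H, sum_insert hi, hC]
      rw [div_eq_iff two_ne_zero, mul_comm _ (2 : ℝ), ← mul_assoc, ← h]
      congr 2
      · ring
      · simp [g]; ring
    rw [hsym, expect_congr rfl fun ε _ => hpt ε, ← expect_mul, ih, prod_insert hi]
    ring

/-- The small ball probability of a signed sum is at most the return probability of the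
lazy walk. -/
lemma expect_signed_sum_eq_le (hp : p ≠ 2) (y : ι → ZMod p) (C : Finset ι) (x : ZMod p) :
    𝔼 ε : ι → ℤˣ, ind (∑ j ∈ C, ((ε j : ℤ) : ZMod p) * y j = x) ≤ returnProb y C := by
  have hp0 := prime_cast_pos (p := p)
  have h1 : ∀ ε : ι → ℤˣ, ind (∑ j ∈ C, ((ε j : ℤ) : ZMod p) * y j = x) =
      (∑ ξ, cosChar ((∑ j ∈ C, ((ε j : ℤ) : ZMod p) * y j + -x) * ξ)) / p := by
    intro ε
    rw [sum_cosChar_mul, ← sub_eq_add_neg]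
    by_cases h : ∑ j ∈ C, ((ε j : ℤ) : ZMod p) * y j = x
    · rw [ind_of_true h, if_pos (sub_eq_zero.2 h), div_self hp0.ne']
    · rw [ind_of_false h, if_neg (sub_ne_zero.2 h), zero_div]
  rw [expect_congr rfl fun ε _ => h1 ε, ← expect_div, expect_sum_comm, returnProb]
  refine div_le_div_of_nonneg_right ?_ hp0.le
  refine le_trans (sum_le_sum fun ξ _ => ?_) (sum_prod_abs_cosChar_le hp y C)
  rw [expect_cosChar_signed_sum, ← abs_prod]
  refine (le_abs_self _).trans ?_
  rw [abs_mul]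
  exact mul_le_of_le_one_left (abs_nonneg _) (abs_cosChar_le_one _)

/-- The symmetric matrix over `ℤ/pℤ` with signs given by a function on unordered pairs. -/
def signMatrix (p : ℕ) {ι : Type*} (f : Sym2 ι → ℤˣ) : Matrix ι ι (ZMod p) :=
  Matrix.of fun i j => ((f s(i, j) : ℤ) : ZMod p)

/-- The rows of `M v = w` indexed by `B` hold. -/
def RowsHold (f : Sym2 ι → ℤˣ) (v w : ι → ZMod p) (B : Finset ι) : Prop :=
  ∀ b ∈ B, ∑ j, ((f s(b, j) : ℤ) : ZMod p) * v j = w b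

lemma expect_rowsHold_insert_le (hp : p ≠ 2) (v w : ι → ZMod p) {B C : Finset ι} {i : ι}
    (hiB : i ∉ B) (hCB : Disjoint C B) :
    𝔼 f : Sym2 ι → ℤˣ, ind (RowsHold f v w (insert i B)) ≤
      returnProb v C * 𝔼 f : Sym2 ι → ℤˣ, ind (RowsHold f v w B) := by
  set g : (ι → ℤˣ) → Sym2 ι → ℤˣ := fun ε e => ∏ j ∈ C, if e = s(i, j) then ε j else 1
  have hgC : ∀ ε, ∀ j ∈ C, g ε s(i, j) = ε j := fun ε j hj => by
    simp only [g, Sym2.congr_right]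
    rw [prod_ite_eq, if_pos hj]
  have hgC' : ∀ ε, ∀ j ∉ C, g ε s(i, j) = 1 := fun ε j hj => by
    simp only [g, Sym2.congr_right]
    rw [prod_ite_eq, if_neg hj]
  have hgB : ∀ ε, ∀ b ∈ B, ∀ j, g ε s(b, j) = 1 := fun ε b hb j => by
    refine prod_eq_one fun k hk => if_neg fun h => ?_
    rcases Sym2.eq_iff.1 h with ⟨h, -⟩ | ⟨h, -⟩
    · exact hiB (h ▸ hb)
    · exact disjoint_left.1 hCB hk (h ▸ hb)
  have hpt : ∀ (f : Sym2 ι → ℤˣ) (ε : ι → ℤˣ), ind (RowsHold (g ε * f) v w (insert i B)) =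
      ind (∑ j ∈ C, ((ε j : ℤ) : ZMod p) * (((f s(i, j) : ℤ) : ZMod p) * v j) =
        w i - ∑ j ∈ Cᶜ, ((f s(i, j) : ℤ) : ZMod p) * v j) * ind (RowsHold f v w B) := by
    intro f ε
    rw [← ind_and]
    congr 1
    simp only [RowsHold, forall_mem_insert, eq_sub_iff_add_eq, Pi.mul_apply]
    refine propext (and_congr ?_ (forall₂_congr fun b hb => ?_))
    · rw [← sum_add_sum_compl C]
      rw [sum_congr rfl fun j hj => by rw [hgC ε j hj],
        sum_congr (s₁ := Cᶜ) rfl fun j hj => by rw [hgC' ε j (mem_compl.1 hj), one_mul]]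
      simp [mul_assoc]
    · simp [hgB ε b hb]
  calc 𝔼 f : Sym2 ι → ℤˣ, ind (RowsHold f v w (insert i B))
      = 𝔼 ε : ι → ℤˣ, 𝔼 f : Sym2 ι → ℤˣ, ind (RowsHold (g ε * f) v w (insert i B)) := by
        simp_rw [expect_comp_mul_left (g _) fun f => ind (RowsHold f v w (insert i B))]
        rw [expect_const univ_nonempty]
    _ = 𝔼 f : Sym2 ι → ℤˣ, (𝔼 ε : ι → ℤˣ, ind (∑ j ∈ C, ((ε j : ℤ) : ZMod p) *
          (((f s(i, j) : ℤ) : ZMod p) * v j) =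
            w i - ∑ j ∈ Cᶜ, ((f s(i, j) : ℤ) : ZMod p) * v j)) * ind (RowsHold f v w B) := by
        rw [expect_comm]
        refine expect_congr rfl fun f _ => ?_
        rw [expect_mul]
        exact expect_congr rfl fun ε _ => hpt f ε
    _ ≤ 𝔼 f : Sym2 ι → ℤˣ, returnProb v C * ind (RowsHold f v w B) := by
        refine expect_mono fun f => mul_le_mul_of_nonneg_right ?_ (ind_nonneg _)
        refine (expect_signed_sum_eq_le hp _ C _).trans (le_of_eq ?_)
        simp [returnProb, walkChar, mul_assoc, cosChar_units_mul]
    _ = _ := by rw [← mul_expect]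

lemma expect_rowsHold_union_le (hp : p ≠ 2) (v w : ι → ZMod p) {A B C : Finset ι}
    (hAB : Disjoint A B) (hCA : Disjoint C A) (hCB : Disjoint C B) :
    𝔼 f : Sym2 ι → ℤˣ, ind (RowsHold f v w (A ∪ B)) ≤
      returnProb v C ^ #A * 𝔼 f : Sym2 ι → ℤˣ, ind (RowsHold f v w B) := by
  induction A using Finset.induction_on with
  | empty => simp
  | insert i A hi ih =>
    rw [disjoint_insert_left] at hAB
    rw [disjoint_insert_right] at hCA
    rw [insert_union, card_insert_of_notMem hi, pow_succ', mul_assoc]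
    refine (expect_rowsHold_insert_le hp v w (i := i) ?_
      (disjoint_union_right.2 ⟨hCA.2, hCB⟩)).trans ?_
    · rw [mem_union, not_or]; exact ⟨hi, hAB.1⟩
    · exact mul_le_mul_of_nonneg_left (ih hAB.2 hCA.2) (returnProb_pos v C).le

/-- Exposing first the rows outside `U`, then those in `U \ T`. -/
lemma expect_mulVec_eq_le (hp : p ≠ 2) (v w : ι → ZMod p) {T U : Finset ι} (hTU : T ⊆ U) :
    𝔼 f : Sym2 ι → ℤˣ, ind ((signMatrix p f).mulVec v = w) ≤
      returnProb v T ^ #(U \ T) * returnProb v U ^ #Uᶜ := by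
  have h1 := expect_rowsHold_union_le hp v w (A := Uᶜ) (B := ∅) (C := U) (by simp)
    disjoint_compl_right (by simp)
  have h2 := expect_rowsHold_union_le hp v w (A := U \ T) (B := Uᶜ) (C := T)
    (disjoint_compl_right.mono_left sdiff_subset) disjoint_sdiff
    (disjoint_compl_right.mono_left hTU)
  have h3 : 𝔼 f : Sym2 ι → ℤˣ, ind (RowsHold f v w ∅) = 1 := by
    simp [RowsHold, ind, expect_const univ_nonempty]
  rw [h3, mul_one, union_empty] at h1
  refine (expect_mono fun f => ind_mono fun h => ?_).trans
    (h2.trans (mul_le_mul_of_nonneg_left h1 (pow_nonneg (returnProb_pos v T).le _)))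
  intro b _
  rw [← h]; rfl

end SmallBall

section Counting

variable {p : ℕ} [Fact p.Prime] {ι : Type*} [Fintype ι] [DecidableEq ι]

lemma sum_ind_add_mem (K : Finset (ZMod p)) (x : ZMod p) : ∑ t, ind (x + t ∈ K) = #K := by
  have h : ∑ t, ind (x + t ∈ K) = ∑ t, ind (t ∈ K) :=
    Fintype.sum_equiv (Equiv.addLeft x) _ _ fun _ => rfl
  have h' : ∀ t, ind (t ∈ K) = if t ∈ K then 1 else 0 := fun t => by
    unfold ind; congr
  rw [h]
  simp [h']

lemma card_mul_sum_le {Φ a : (ι → ZMod p) → ℝ} {K : (ι → ZMod p) → Finset (ZMod p)} {c : ℝ} (i : ι)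
    (hΦ : ∀ v, 0 ≤ Φ v) (hc : ∀ v, a v * #(K v) ≤ c)
    (hΦi : ∀ v w, (∀ j, j ≠ i → v j = w j) → Φ v = Φ w)
    (hai : ∀ v w, (∀ j, j ≠ i → v j = w j) → a v = a w)
    (hKi : ∀ v w, (∀ j, j ≠ i → v j = w j) → K v = K w) :
    p * ∑ v, Φ v * (a v * ind (v i ∈ K v)) ≤ c * ∑ v, Φ v := by
  have h1 : ∀ t : ZMod p, ∑ v, Φ v * (a v * ind (v i ∈ K v)) =
      ∑ v, Φ v * (a v * ind (v i + t ∈ K v)) := fun t => by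
    symm
    refine Fintype.sum_equiv (Equiv.addRight (Pi.single i t)) _ _ fun v => ?_
    have h : ∀ j, j ≠ i → v j = (v + Pi.single i t : ι → ZMod p) j := fun j hj => by simp [hj]
    simp only [Equiv.coe_addRight]
    rw [← hΦi _ _ h, ← hai _ _ h, ← hKi _ _ h]
    simp
  calc (p : ℝ) * ∑ v, Φ v * (a v * ind (v i ∈ K v))
      = ∑ _t : ZMod p, ∑ v, Φ v * (a v * ind (v i ∈ K v)) := by
        rw [sum_const, card_univ, ZMod.card, nsmul_eq_mul]
    _ = ∑ v, Φ v * (a v * #(K v)) := by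
        rw [sum_congr rfl fun t _ => h1 t, sum_comm]
        refine sum_congr rfl fun v _ => ?_
        rw [← mul_sum, ← mul_sum, sum_ind_add_mem]
    _ ≤ ∑ v, Φ v * c := sum_le_sum fun v _ => mul_le_mul_of_nonneg_left (hc v) (hΦ v)
    _ = c * ∑ v, Φ v := by rw [← sum_mul, mul_comm]

lemma card_pow_mul_sum_le {Φ a : (ι → ZMod p) → ℝ} {K : (ι → ZMod p) → Finset (ZMod p)} {c : ℝ}
    (B : Finset ι) (hc0 : 0 ≤ c)
    (hΦ : ∀ v, 0 ≤ Φ v) (ha : ∀ v, 0 ≤ a v) (hc : ∀ v, a v * #(K v) ≤ c)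
    (hΦB : ∀ v w, (∀ j ∉ B, v j = w j) → Φ v = Φ w)
    (haB : ∀ v w, (∀ j ∉ B, v j = w j) → a v = a w)
    (hKB : ∀ v w, (∀ j ∉ B, v j = w j) → K v = K w) :
    p ^ #B * ∑ v, Φ v * (a v ^ #B * ind (∀ i ∈ B, v i ∈ K v)) ≤ c ^ #B * ∑ v, Φ v := by
  induction B using Finset.induction_on generalizing Φ with
  | empty => simp [ind]
  | insert i B hi ih =>
    have hsub : ∀ {v w : ι → ZMod p}, (∀ j ∉ B, v j = w j) → ∀ j ∉ insert i B, v j = w j :=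
      fun h j hj => h j fun hj' => hj (mem_insert_of_mem hj')
    have hsub' : ∀ {v w : ι → ZMod p}, (∀ j, j ≠ i → v j = w j) → ∀ j ∉ insert i B, v j = w j :=
      fun h j hj => h j fun hj' => hj (hj' ▸ mem_insert_self _ _)
    have h1 := ih (Φ := fun v => Φ v * (a v * ind (v i ∈ K v)))
      (fun v => mul_nonneg (hΦ v) (mul_nonneg (ha v) (ind_nonneg _)))
      (fun v w h => by
        rw [hΦB v w (hsub h), haB v w (hsub h), hKB v w (hsub h), h i hi])
      (fun v w h => haB v w (hsub h)) (fun v w h => hKB v w (hsub h))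
    have h2 := card_mul_sum_le i hΦ hc (fun v w h => hΦB v w (hsub' h))
      (fun v w h => haB v w (hsub' h)) (fun v w h => hKB v w (hsub' h))
    rw [card_insert_of_notMem hi, pow_succ', pow_succ']
    calc (p : ℝ) * p ^ #B * ∑ v, Φ v * (a v ^ (#B + 1) * ind (∀ j ∈ insert i B, v j ∈ K v))
        = p * (p ^ #B * ∑ v, Φ v * (a v * ind (v i ∈ K v)) *
            (a v ^ #B * ind (∀ j ∈ B, v j ∈ K v))) := by
          rw [mul_assoc]
          congr 2
          refine sum_congr rfl fun v _ => ?_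
          rw [forall_mem_insert, ind_and]
          ring
      _ ≤ p * (c ^ #B * ∑ v, Φ v * (a v * ind (v i ∈ K v))) := by gcongr
      _ = c ^ #B * (p * ∑ v, Φ v * (a v * ind (v i ∈ K v))) := by ring
      _ ≤ c ^ #B * (c * ∑ v, Φ v) := by gcongr
      _ = _ := by ring

/-- The total weight of the vectors whose coordinates in `U \ T` are heavy points of `T`
and whose coordinates outside `U` lie in sets determined by the coordinates in `U`. -/
lemma sum_heavy_le {a : (ι → ZMod p) → ℝ} {K : (ι → ZMod p) → Finset (ZMod p)} {c : ℝ}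
    {T U : Finset ι} (hTU : T ⊆ U) (hc0 : 0 ≤ c) (ha : ∀ v, 0 ≤ a v)
    (hc : ∀ v, a v * #(K v) ≤ c)
    (haU : ∀ v w, (∀ j ∈ U, v j = w j) → a v = a w)
    (hKU : ∀ v w, (∀ j ∈ U, v j = w j) → K v = K w) :
    ∑ v : ι → ZMod p,
      returnProb v T ^ #(U \ T) * ind (∀ j ∈ U \ T, v j ∈ heavyPoints v T) *
        (a v ^ #Uᶜ * ind (∀ j ∈ Uᶜ, v j ∈ K v)) ≤
      p ^ #T * 2 ^ #(U \ T) * c ^ #Uᶜ := by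
  have hp := prime_cast_pos (p := p)
  have hcompl : ∀ {v w : ι → ZMod p}, (∀ j ∉ Uᶜ, v j = w j) → ∀ j ∈ U, v j = w j :=
    fun h j hj => h j (by simpa using hj)
  have hdiff : ∀ {v w : ι → ZMod p}, (∀ j ∉ U \ T, v j = w j) → ∀ j ∈ T, v j = w j :=
    fun h j hj => h j (by simp [hj])
  have h1 := card_pow_mul_sum_le (p := p) (ι := ι)
    (Φ := fun v => returnProb v T ^ #(U \ T) * ind (∀ j ∈ U \ T, v j ∈ heavyPoints v T))
    (a := a) (K := K) (c := c) Uᶜ hc0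
    (fun v => mul_nonneg (pow_nonneg (returnProb_pos v T).le _) (ind_nonneg _)) ha hc
    (fun v w h => by
      have hT : ∀ j ∈ T, v j = w j := fun j hj => hcompl h j (hTU hj)
      rw [returnProb_congr hT, heavyPoints_congr hT]
      congr 2
      exact propext (forall₂_congr fun j hj => by rw [hcompl h j (sdiff_subset hj)]))
    (fun v w h => haU v w (hcompl h)) (fun v w h => hKU v w (hcompl h))
  have h2 := card_pow_mul_sum_le (p := p) (ι := ι) (Φ := fun _ => 1)
    (a := fun v => returnProb v T) (K := fun v => heavyPoints v T) (c := 2) (U \ T) (by norm_num)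
    (fun _ => zero_le_one) (fun v => (returnProb_pos v T).le)
    (fun v => returnProb_mul_card_heavyPoints_le v T) (fun _ _ _ => rfl)
    (fun v w h => returnProb_congr (hdiff h)) (fun v w h => heavyPoints_congr (hdiff h))
  simp only [one_mul, sum_const, card_univ, Fintype.card_fun, ZMod.card, nsmul_eq_mul, mul_one]
    at h2
  have hcard : Fintype.card ι = #T + #(U \ T) + #Uᶜ := by
    rw [add_comm #T, card_sdiff_add_card_eq_card hTU, card_add_card_compl]
  rw [hcard, Nat.cast_pow, pow_add, pow_add] at h2
  have hV : (0 : ℝ) < p ^ #(U \ T) := by positivity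
  have hG : (0 : ℝ) < p ^ #Uᶜ := by positivity
  refine le_of_mul_le_mul_left (h1.trans ?_) hG
  refine le_of_mul_le_mul_left ?_ hV
  calc _ = c ^ #Uᶜ * (p ^ #(U \ T) * ∑ v : ι → ZMod p, returnProb v T ^ #(U \ T) *
        ind (∀ j ∈ U \ T, v j ∈ heavyPoints v T)) := by ring
    _ ≤ c ^ #Uᶜ * (2 ^ #(U \ T) * (p ^ #T * p ^ #(U \ T) * p ^ #Uᶜ)) := by gcongr
    _ = _ := by ring

/-- Bound for the vectors vanishing outside a small set `U`. -/
lemma sum_sparse_le {T U : Finset ι} (hTU : T ⊆ U) :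
    ∑ v : ι → ZMod p,
      returnProb v T ^ #(U \ T) * ind (∀ j ∈ U \ T, v j ∈ heavyPoints v T) *
        (((7 / 8) ^ #T) ^ #Uᶜ * ind (∀ j ∈ Uᶜ, v j ∈ ({0} : Finset (ZMod p)))) ≤
      p ^ #T * 2 ^ #(U \ T) * ((7 / 8) ^ #T) ^ #Uᶜ :=
  sum_heavy_le (a := fun _ => (7 / 8) ^ #T) (K := fun _ => {0}) hTU (by positivity)
    (fun _ => by positivity) (fun _ => by simp) (fun _ _ _ => rfl) fun _ _ _ => rfl

/-- Bound for the vectors whose coordinates outside `U` are heavy points of `S`. -/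
lemma sum_dense_le {S T U : Finset ι} (hTU : T ⊆ U) (hSU : S ⊆ U) {δ : ℝ} (hδ : 0 ≤ δ) :
    ∑ v : ι → ZMod p,
      returnProb v T ^ #(U \ T) * ind (∀ j ∈ U \ T, v j ∈ heavyPoints v T) *
        ((δ * returnProb v S) ^ #Uᶜ * ind (∀ j ∈ Uᶜ, v j ∈ heavyPoints v S)) ≤
      p ^ #T * 2 ^ #(U \ T) * (2 * δ) ^ #Uᶜ :=
  sum_heavy_le (a := fun v => δ * returnProb v S) (K := fun v => heavyPoints v S) hTU
    (by positivity) (fun v => mul_nonneg hδ (returnProb_pos v S).le)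
    (fun v => by
      rw [mul_assoc, mul_comm 2]
      exact mul_le_mul_of_nonneg_left (returnProb_mul_card_heavyPoints_le v S) hδ)
    (fun v w h => by rw [returnProb_congr fun j hj => h j (hSU hj)])
    fun v w h => heavyPoints_congr fun j hj => h j (hSU hj)

end Counting

section Structured

variable {p : ℕ} [Fact p.Prime] {ι : Type*} [Fintype ι] [DecidableEq ι]

/-- Nonzero vectors whose random walk is noticeably more concentrated than the uniform
distribution. -/
def Structured (v : ι → ZMod p) : Prop := v ≠ 0 ∧ 2 / (p : ℝ) ≤ returnProb v univ

lemma expect_mulVec_eq_le_add (hp : p ≠ 2) (w : ι → ZMod p) {v : ι → ZMod p} (hv : Structured v)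
    (r : ℕ) {D s : ℕ} (hD : ∀ T, returnProb v T ≤ (7 / 8) ^ #T → #T ≤ D)
    (hs : (8 ^ r + 1) * D ≤ s) :
    𝔼 f : Sym2 ι → ℤˣ, ind ((signMatrix p f).mulVec v = w) ≤
      ∑ x : Finset ι × Finset ι with x.1 ⊆ x.2 ∧ #x.2 ≤ s ∧ x.1.Nonempty,
        returnProb v x.1 ^ #(x.2 \ x.1) * ind (∀ j ∈ x.2 \ x.1, v j ∈ heavyPoints v x.1) *
          (((7 / 8) ^ #x.1) ^ #x.2ᶜ * ind (∀ j ∈ x.2ᶜ, v j ∈ ({0} : Finset (ZMod p)))) +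
      ∑ x : Finset ι × Finset ι × Finset ι with x.1 ⊆ x.2.1 ∧ x.2.2 ⊆ x.2.1 ∧ #x.1 ≤ D ∧ #x.2.1 ≤ s,
        returnProb v x.1 ^ #(x.2.1 \ x.1) * ind (∀ j ∈ x.2.1 \ x.1, v j ∈ heavyPoints v x.1) *
          ((20 / 2 ^ r * returnProb v x.2.2) ^ #x.2.1ᶜ *
            ind (∀ j ∈ x.2.1ᶜ, v j ∈ heavyPoints v x.2.2)) := by
  obtain ⟨T, U, hTU, hUs, hT, hheavy, h⟩ := exists_decomposition v r hD
  have hind : ind (∀ j ∈ U \ T, v j ∈ heavyPoints v T) = 1 :=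
    ind_of_true fun j hj => hheavy j (mem_sdiff.1 hj).2
  have hT0 : ∀ T, 0 ≤ returnProb v T := fun T => (returnProb_pos v T).le
  refine (expect_mulVec_eq_le hp v w hTU).trans ?_
  rcases h with hz | ⟨S, hSU, hS, hU⟩
  · have hTne : T.Nonempty := by
      rw [nonempty_iff_ne_empty]
      rintro rfl
      exact hv.1 (funext fun j => eq_zero_of_mem_heavyPoints_empty (hheavy j (notMem_empty j)))
    refine le_add_of_le_of_nonneg ?_ (sum_nonneg fun x _ => ?_)
    · refine le_trans ?_ (single_le_sum (fun x _ => ?_)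
        (mem_filter.2 ⟨mem_univ (T, U), hTU, hUs.trans hs, hTne⟩))
      · rw [hind, ind_of_true fun j hj => by simpa using hz j (mem_compl.1 hj), mul_one, mul_one]
        gcongr
        · exact pow_nonneg (hT0 _) _
        · exact hT0 _
        · exact (returnProb_anti v hTU).trans hT
      · exact mul_nonneg (mul_nonneg (pow_nonneg (hT0 _) _) (ind_nonneg _))
          (mul_nonneg (by positivity) (ind_nonneg _))
    · exact mul_nonneg (mul_nonneg (pow_nonneg (hT0 _) _) (ind_nonneg _))
        (mul_nonneg (pow_nonneg (mul_nonneg (by positivity) (hT0 _)) _) (ind_nonneg _))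
  · refine le_add_of_nonneg_of_le (sum_nonneg fun x _ => ?_) ?_
    · exact mul_nonneg (mul_nonneg (pow_nonneg (hT0 _) _) (ind_nonneg _))
          (mul_nonneg (by positivity) (ind_nonneg _))
    · refine le_trans ?_ (single_le_sum (fun x _ => ?_)
        (mem_filter.2 ⟨mem_univ (T, U, S), hTU, hSU, hD T hT, hUs.trans hs⟩))
      · rw [hind, ind_of_true fun j hj => hS j (mem_compl.1 hj), mul_one, mul_one]
        gcongr
        · exact pow_nonneg (hT0 _) _
        · exact hT0 _
        · have h1 := hv.2.trans (returnProb_anti v (subset_univ U))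
          have h2 : 2 / (p : ℝ) = 2 * (1 / p) := by ring
          have h3 : 20 / 2 ^ r * returnProb v S = 2 * (10 / 2 ^ r * returnProb v S) := by ring
          linarith
      · exact mul_nonneg (mul_nonneg (pow_nonneg (hT0 _) _) (ind_nonneg _))
          (mul_nonneg (pow_nonneg (mul_nonneg (by positivity) (hT0 _)) _) (ind_nonneg _))

lemma card_le_pow_of_card_le {ι : Type*} [Fintype ι] (s : ℕ) :
    (#{U : Finset ι | #U ≤ s} : ℝ) ≤ 100 ^ s * (101 / 100) ^ Fintype.card ι := by
  have h : ∑ U : Finset ι, ((1 : ℝ) / 100) ^ #U = (101 / 100) ^ Fintype.card ι := by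
    have := Finset.sum_pow_mul_eq_add_pow ((1 : ℝ) / 100) 1 (univ : Finset ι)
    rw [powerset_univ, card_univ] at this
    simp only [one_pow, mul_one] at this
    rw [this]; norm_num
  rw [← h, mul_sum, card_eq_sum_ones, Nat.cast_sum]
  refine (sum_le_sum fun U hU => ?_).trans
    (sum_le_sum_of_subset_of_nonneg (filter_subset _ univ) fun _ _ _ => by positivity)
  have hU := (mem_filter.1 hU).2
  rw [Nat.cast_one, one_div, inv_pow, ← div_eq_mul_inv, one_le_div (by positivity)]
  exact pow_le_pow_right₀ (by norm_num) hU

lemma sum_sparse_total_le {p s h : ℕ} (hsh : s + h ≤ Fintype.card ι)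
    (hx : (p : ℝ) * (7 / 8) ^ h ≤ 1) :
    ∑ x : Finset ι × Finset ι with x.1 ⊆ x.2 ∧ #x.2 ≤ s ∧ x.1.Nonempty,
      (p : ℝ) ^ #x.1 * 2 ^ #(x.2 \ x.1) * ((7 / 8) ^ #x.1) ^ #x.2ᶜ ≤
      p * (7 / 8) ^ h * 400 ^ s * (101 / 100) ^ Fintype.card ι := by
  have hterm : ∀ x ∈ ({x : Finset ι × Finset ι | x.1 ⊆ x.2 ∧ #x.2 ≤ s ∧ x.1.Nonempty} :
      Finset _), (p : ℝ) ^ #x.1 * 2 ^ #(x.2 \ x.1) * ((7 / 8) ^ #x.1) ^ #x.2ᶜ ≤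
        p * (7 / 8) ^ h * 2 ^ s := by
    intro x hx'
    obtain ⟨-, -, hs, hne⟩ := mem_filter.1 hx'
    have hc : h ≤ #x.2ᶜ := by rw [card_compl]; omega
    calc (p : ℝ) ^ #x.1 * 2 ^ #(x.2 \ x.1) * ((7 / 8) ^ #x.1) ^ #x.2ᶜ
        = (p * (7 / 8) ^ #x.2ᶜ) ^ #x.1 * 2 ^ #(x.2 \ x.1) := by
          rw [mul_pow, ← pow_mul, ← pow_mul, mul_comm #x.2ᶜ]; ring
      _ ≤ (p * (7 / 8) ^ h) ^ #x.1 * 2 ^ s := by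
          gcongr ?_ ^ _ * ?_
          · gcongr ?_ * ?_
            exact pow_le_pow_of_le_one (by norm_num) (by norm_num) hc
          · exact pow_le_pow_right₀ (by norm_num) ((card_le_card sdiff_subset).trans hs)
      _ ≤ _ := by
          gcongr
          exact pow_le_of_le_one (by positivity) hx hne.card_ne_zero
  have hcard : (#({x : Finset ι × Finset ι | x.1 ⊆ x.2 ∧ #x.2 ≤ s ∧ x.1.Nonempty} :
      Finset _) : ℝ) ≤ 2 ^ s * (100 ^ s * (101 / 100) ^ Fintype.card ι) := by
    refine le_trans ?_ (mul_le_mul_of_nonneg_left (card_le_pow_of_card_le s) (by positivity))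
    have : #({x : Finset ι × Finset ι | x.1 ⊆ x.2 ∧ #x.2 ≤ s ∧ x.1.Nonempty} : Finset _) ≤
        2 ^ s * #{U : Finset ι | #U ≤ s} := by
      refine card_le_mul_card_image_of_maps_to (f := Prod.snd) (fun x hx => ?_) _ fun U hU => ?_
      · simpa using (mem_filter.1 hx).2.2.1
      · have hU := (mem_filter.1 hU).2
        refine le_trans (card_le_card_of_injOn (t := U.powerset) Prod.fst (fun x hx => ?_) ?_) ?_
        · simp only [coe_filter, Set.mem_ofPred_eq, mem_filter, mem_univ, true_and] at hx
          simpa [hx.2] using hx.1.1.trans_eq hx.2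
        · intro x hx y hy hxy
          simp only [coe_filter, Set.mem_ofPred_eq] at hx hy
          exact Prod.ext hxy (hx.2.trans hy.2.symm)
        · rw [card_powerset]
          exact Nat.pow_le_pow_right (by norm_num) hU
    exact_mod_cast this
  refine (sum_le_card_nsmul _ _ _ hterm).trans ?_
  rw [nsmul_eq_mul]
  refine (mul_le_mul_of_nonneg_right hcard (by positivity)).trans (le_of_eq ?_)
  rw [show (400 : ℝ) = 2 * 100 * 2 by norm_num, mul_pow, mul_pow]
  ring

lemma sum_dense_total_le {D s h r : ℕ} (hsh : s + h ≤ Fintype.card ι)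
    (hr : (40 : ℝ) / 2 ^ r ≤ 1) :
    ∑ x : Finset ι × Finset ι × Finset ι with x.1 ⊆ x.2.1 ∧ x.2.2 ⊆ x.2.1 ∧ #x.1 ≤ D ∧ #x.2.1 ≤ s,
      (p : ℝ) ^ #x.1 * 2 ^ #(x.2.1 \ x.1) * (2 * (20 / 2 ^ r)) ^ #x.2.1ᶜ ≤
      p ^ D * 16 ^ Fintype.card ι * (40 / 2 ^ r) ^ h := by
  have hp1 : (1 : ℝ) ≤ p := by exact_mod_cast (Fact.out : p.Prime).one_le
  refine (sum_le_card_nsmul _ _ ((p : ℝ) ^ D * 2 ^ Fintype.card ι * (40 / 2 ^ r) ^ h) ?_).trans ?_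
  · intro x hx
    obtain ⟨-, -, -, hD, hs⟩ := mem_filter.1 hx
    have hc : h ≤ #x.2.1ᶜ := by rw [card_compl]; omega
    rw [show (2 : ℝ) * (20 / 2 ^ r) = 40 / 2 ^ r by ring]
    gcongr ?_ * ?_ * ?_
    · exact pow_le_pow_right₀ hp1 hD
    · exact pow_le_pow_right₀ (by norm_num) (card_le_univ _)
    · exact pow_le_pow_of_le_one (by positivity) hr hc
  · rw [nsmul_eq_mul]
    have : (#({x : Finset ι × Finset ι × Finset ι | x.1 ⊆ x.2.1 ∧ x.2.2 ⊆ x.2.1 ∧ #x.1 ≤ D ∧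
        #x.2.1 ≤ s} : Finset _) : ℝ) ≤ 8 ^ Fintype.card ι := by
      have := card_le_univ ({x : Finset ι × Finset ι × Finset ι | x.1 ⊆ x.2.1 ∧ x.2.2 ⊆ x.2.1 ∧
        #x.1 ≤ D ∧ #x.2.1 ≤ s} : Finset _)
      rw [Fintype.card_prod, Fintype.card_prod, Fintype.card_finset, ← mul_pow, ← mul_pow] at this
      exact_mod_cast this
    refine (mul_le_mul_of_nonneg_right this (by positivity)).trans (le_of_eq ?_)
    rw [show (16 : ℝ) = 8 * 2 by norm_num, mul_pow]
    ring

/-- The union bound over structured vectors. -/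
lemma sum_structured_le (hp : p ≠ 2) (w : ι → ZMod p) {D h r s : ℕ}
    (hD : (p : ℝ) * (7 / 8) ^ D < 1) (hs : (8 ^ r + 1) * D ≤ s) (hsh : s + h ≤ Fintype.card ι)
    (hx : (p : ℝ) * (7 / 8) ^ h ≤ 1) (hr : (40 : ℝ) / 2 ^ r ≤ 1) :
    ∑ v : ι → ZMod p, ind (Structured v) *
        𝔼 f : Sym2 ι → ℤˣ, ind ((signMatrix p f).mulVec v = w) ≤
      p * (7 / 8) ^ h * 400 ^ s * (101 / 100) ^ Fintype.card ι +
        p ^ D * 16 ^ Fintype.card ι * (40 / 2 ^ r) ^ h := by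
  have hp0 := prime_cast_pos (p := p)
  have hD' : ∀ (v : ι → ZMod p) T, returnProb v T ≤ (7 / 8) ^ #T → #T ≤ D := fun v T hT => by
    by_contra! hlt
    have h1 : 1 / (p : ℝ) ≤ (7 / 8) ^ D := (inv_prime_le_returnProb v T).trans
      (hT.trans (pow_le_pow_of_le_one (by norm_num) (by norm_num) hlt.le))
    rw [div_le_iff₀' hp0] at h1
    linarith
  refine (sum_le_sum (g := fun v =>
      ∑ x : Finset ι × Finset ι with x.1 ⊆ x.2 ∧ #x.2 ≤ s ∧ x.1.Nonempty,
        returnProb v x.1 ^ #(x.2 \ x.1) * ind (∀ j ∈ x.2 \ x.1, v j ∈ heavyPoints v x.1) *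
          (((7 / 8) ^ #x.1) ^ #x.2ᶜ * ind (∀ j ∈ x.2ᶜ, v j ∈ ({0} : Finset (ZMod p)))) +
      ∑ x : Finset ι × Finset ι × Finset ι with x.1 ⊆ x.2.1 ∧ x.2.2 ⊆ x.2.1 ∧ #x.1 ≤ D ∧ #x.2.1 ≤ s,
        returnProb v x.1 ^ #(x.2.1 \ x.1) * ind (∀ j ∈ x.2.1 \ x.1, v j ∈ heavyPoints v x.1) *
          ((20 / 2 ^ r * returnProb v x.2.2) ^ #x.2.1ᶜ *
            ind (∀ j ∈ x.2.1ᶜ, v j ∈ heavyPoints v x.2.2))) fun v _ => ?_).trans ?_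
  · by_cases hv : Structured v
    · rw [ind_of_true hv, one_mul]
      exact expect_mulVec_eq_le_add hp w hv r (hD' v) hs
    · rw [ind_of_false hv, zero_mul]
      have hT0 : ∀ T, 0 ≤ returnProb v T := fun T => (returnProb_pos v T).le
      refine add_nonneg (sum_nonneg fun x _ => ?_) (sum_nonneg fun x _ => ?_)
      · exact mul_nonneg (mul_nonneg (pow_nonneg (hT0 _) _) (ind_nonneg _))
          (mul_nonneg (by positivity) (ind_nonneg _))
      · exact mul_nonneg (mul_nonneg (pow_nonneg (hT0 _) _) (ind_nonneg _))
          (mul_nonneg (pow_nonneg (mul_nonneg (by positivity) (hT0 _)) _) (ind_nonneg _))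
  · rw [sum_add_distrib, sum_comm, sum_comm (s := univ)]
    refine add_le_add ((sum_le_sum fun x hx' => ?_).trans (sum_sparse_total_le hsh hx))
      ((sum_le_sum fun x hx' => ?_).trans (sum_dense_total_le hsh hr))
    · exact sum_sparse_le (mem_filter.1 hx').2.1
    · exact sum_dense_le (mem_filter.1 hx').2.1 (mem_filter.1 hx').2.2.1 (by positivity)

end Structured

section Corank

variable {K : Type*} [Field K] {ι κ : Type*} [Fintype ι] [Fintype κ]

/-- The dimension of the kernel of a square matrix. -/
noncomputable def corank (M : Matrix ι ι K) : ℕ := Module.finrank K (LinearMap.ker M.mulVecLin)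

lemma rank_add_corank (M : Matrix ι ι K) : M.rank + corank M = Fintype.card ι := by
  have := LinearMap.finrank_range_add_finrank_ker M.mulVecLin
  rwa [Module.finrank_fintype_fun_eq_card] at this

lemma corank_le_card (M : Matrix ι ι K) : corank M ≤ Fintype.card ι := by
  have := rank_add_corank M
  omega

lemma corank_submatrix (e : κ ≃ ι) (M : Matrix ι ι K) : corank (M.submatrix e e) = corank M := by
  have h1 := rank_add_corank M
  have h2 := rank_add_corank (M.submatrix e e)
  rw [Matrix.rank_submatrix, Fintype.card_congr e] at h2
  omega

lemma corank_pos_of_mulVec_eq_zero {M : Matrix ι ι K} {v : ι → K} (hv : v ≠ 0) (h : M *ᵥ v = 0) :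
    0 < corank M := by
  have : Nontrivial (LinearMap.ker M.mulVecLin) :=
    nontrivial_of_ne ⟨v, by simpa using h⟩ 0 fun h => hv (by simpa using h)
  exact Module.finrank_pos

lemma exists_mulVec_eq_zero_of_corank_pos {M : Matrix ι ι K} (h : 0 < corank M) :
    ∃ v ≠ 0, M *ᵥ v = 0 := by
  have : Nontrivial (LinearMap.ker M.mulVecLin) := Module.finrank_pos_iff.1 h
  obtain ⟨v, hv⟩ := exists_ne (0 : LinearMap.ker M.mulVecLin)
  exact ⟨v, fun h => hv (Subtype.ext h), LinearMap.mem_ker.1 v.2⟩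

lemma corank_eq_zero {M : Matrix ι ι K} (h : ∀ v, M *ᵥ v = 0 → v = 0) : corank M = 0 := by
  by_contra hM
  obtain ⟨v, hv, hMv⟩ := exists_mulVec_eq_zero_of_corank_pos (Nat.pos_of_ne_zero hM)
  exact hv (h v hMv)

variable {N : Matrix (Option ι) (Option ι) K}

lemma border_mulVec_some (hN : N.IsSymm) {y : Option ι → K} (hy : N *ᵥ y = 0) :
    N.submatrix some some *ᵥ (y ∘ some) = -(y none • fun i => N none (some i)) := by
  ext i
  have := congrFun hy (some i)
  simp only [Matrix.mulVec, dotProduct, Fintype.sum_option, Pi.zero_apply] at this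
  rw [hN.apply] at this
  simp only [Matrix.mulVec, dotProduct, Matrix.submatrix_apply, Function.comp_apply, Pi.neg_apply,
    Pi.smul_apply, smul_eq_mul]
  linear_combination this

lemma border_mulVec_none {y : Option ι → K} (hy : N *ᵥ y = 0) :
    (fun i => N none (some i)) ⬝ᵥ (y ∘ some) + N none none * y none = 0 := by
  have := congrFun hy none
  simp only [Matrix.mulVec, dotProduct, Fintype.sum_option, Pi.zero_apply] at this
  simp only [dotProduct, Function.comp_apply]
  linear_combination this

/-- Bordering by a vector not orthogonal to the kernel decreases the corank. -/
lemma corank_lt_corank_submatrix (hN : N.IsSymm) {v : ι → K}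
    (hv : N.submatrix some some *ᵥ v = 0) (hx : (fun i => N none (some i)) ⬝ᵥ v ≠ 0) :
    corank N < corank (N.submatrix some some) := by
  set M := N.submatrix some some
  set x : ι → K := fun i => N none (some i)
  have hM : M.IsSymm := hN.submatrix some
  have hnone : ∀ y, N *ᵥ y = 0 → y none = 0 := fun y hy => by
    have h1 : v ⬝ᵥ (M *ᵥ (y ∘ some)) = 0 := by
      rw [Matrix.dotProduct_mulVec, ← Matrix.mulVec_transpose, hM.eq, hv, zero_dotProduct]
    rw [border_mulVec_some hN hy, dotProduct_neg, dotProduct_smul, neg_eq_zero, smul_eq_mul,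
      dotProduct_comm] at h1
    exact (mul_eq_zero.1 h1).resolve_right hx
  let W : Submodule K (ι → K) :=
    LinearMap.ker M.mulVecLin ⊓ LinearMap.ker (dotProductBilin K K x)
  have hW : W < LinearMap.ker M.mulVecLin := by
    refine lt_of_le_of_ne inf_le_left fun h => hx ?_
    have hvW : v ∈ W := h ▸ (by simpa using hv)
    simpa using hvW.2
  refine lt_of_le_of_lt ?_ (Submodule.finrank_lt_finrank_of_lt hW)
  let φ : LinearMap.ker N.mulVecLin →ₗ[K] W :=
    ((LinearMap.funLeft K K some).comp (Submodule.subtype _)).codRestrict W fun y => by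
      have hy : N *ᵥ y.1 = 0 := LinearMap.mem_ker.1 y.2
      have h1 := border_mulVec_some hN hy
      have h2 := border_mulVec_none hy
      rw [hnone _ hy] at h1 h2
      refine ⟨?_, ?_⟩
      · rw [zero_smul, neg_zero] at h1
        exact h1
      · rw [mul_zero, add_zero] at h2
        exact h2
  refine LinearMap.finrank_le_finrank_of_injective (f := φ) ?_
  rw [injective_iff_map_eq_zero]
  intro y hy
  have hy' : N *ᵥ y.1 = 0 := LinearMap.mem_ker.1 y.2
  ext o
  cases o with
  | none => exact hnone _ hy'
  | some i => exact congrFun (congrArg Subtype.val hy) i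

lemma corank_eq_zero_of_border [DecidableEq ι] (hN : N.IsSymm)
    (hdet : IsUnit (N.submatrix some some).det)
    (hx : (fun i => N none (some i)) ⬝ᵥ ((N.submatrix some some)⁻¹ *ᵥ fun i => N none (some i)) ≠
      N none none) : corank N = 0 := by
  refine corank_eq_zero fun y hy => ?_
  have h1 := border_mulVec_some hN hy
  have h2 := border_mulVec_none hy
  set M := N.submatrix some some
  set x : ι → K := fun i => N none (some i)
  have h3 : y ∘ some = -(y none • (M⁻¹ *ᵥ x)) := by
    rw [← Matrix.mulVec_smul, ← Matrix.mulVec_neg, ← h1, Matrix.mulVec_mulVec,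
      Matrix.nonsing_inv_mul _ hdet, Matrix.one_mulVec]
  rw [h3, dotProduct_neg, dotProduct_smul, smul_eq_mul] at h2
  have h4 : y none = 0 := by
    refine (mul_eq_zero.1 (?_ : y none * (N none none - x ⬝ᵥ (M⁻¹ *ᵥ x)) = 0)).resolve_right
      (sub_ne_zero.2 hx.symm)
    linear_combination h2
  rw [h4, zero_smul, neg_zero] at h3
  ext o
  cases o with
  | none => exact h4
  | some i => exact congrFun h3 i

end Corank

section Decoupling

lemma sq_expect_le {Ω : Type*} [Fintype Ω] [Nonempty Ω] (G : Ω → ℝ) :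
    (𝔼 ω, G ω) ^ 2 ≤ 𝔼 ω, G ω ^ 2 := by
  have h : 0 ≤ 𝔼 ω, (G ω - 𝔼 ω', G ω') ^ 2 := expect_nonneg fun ω _ => sq_nonneg _
  have h2 : ∀ ω, (G ω - 𝔼 ω', G ω') ^ 2 =
      G ω ^ 2 - 2 * (𝔼 ω', G ω') * G ω + (𝔼 ω', G ω') ^ 2 := fun ω => by ring
  rw [expect_congr rfl fun ω _ => h2 ω, expect_add_distrib, expect_sub_distrib, ← mul_expect,
    expect_const univ_nonempty] at h
  linarith

lemma sq_expect {Ω : Type*} [Fintype Ω] (G : Ω → ℝ) :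
    (𝔼 ω, G ω) ^ 2 = 𝔼 ω, 𝔼 ω', G ω * G ω' := by
  rw [sq, expect_mul]
  exact expect_congr rfl fun ω _ => mul_expect _ _ _

variable {ι : Type*} [Fintype ι] [DecidableEq ι]

lemma expect_piecewise (I : Finset ι) (F : (ι → ℤˣ) → ℝ) :
    𝔼 b : ι → ℤˣ, 𝔼 a : ι → ℤˣ, F (I.piecewise a b) = 𝔼 x, F x := by
  let φ : (ι → ℤˣ) × (ι → ℤˣ) → (ι → ℤˣ) × (ι → ℤˣ) := fun x =>
    (I.piecewise x.1 x.2, I.piecewise x.2 x.1)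
  have hφ : Function.Involutive φ := fun x => by
    ext i <;> by_cases hi : i ∈ I <;> simp [φ, hi]
  have h : 𝔼 x : (ι → ℤˣ) × (ι → ℤˣ), F (φ x).1 = 𝔼 x : (ι → ℤˣ) × (ι → ℤˣ), F x.1 :=
    Fintype.expect_equiv hφ.toPerm _ _ fun _ => rfl
  rw [← univ_product_univ, expect_product, expect_product] at h
  rw [expect_comm]
  refine h.trans ?_
  simp [expect_const univ_nonempty]

/-- Decoupling by two applications of the Cauchy–Schwarz inequality. -/
lemma expect_pow_four_le (I : Finset ι) (F : (ι → ℤˣ) → ℝ) :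
    (𝔼 x, F x) ^ 4 ≤ 𝔼 a : ι → ℤˣ, 𝔼 a' : ι → ℤˣ, 𝔼 b' : ι → ℤˣ, 𝔼 b : ι → ℤˣ,
      F (I.piecewise a b) * F (I.piecewise a' b) *
        (F (I.piecewise a b') * F (I.piecewise a' b')) := by
  have h1 : (𝔼 x, F x) ^ 2 ≤ 𝔼 a : ι → ℤˣ, 𝔼 a' : ι → ℤˣ, 𝔼 b : ι → ℤˣ,
      F (I.piecewise a b) * F (I.piecewise a' b) := by
    rw [← expect_piecewise I]
    refine (sq_expect_le _).trans (le_of_eq ?_)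
    simp_rw [sq_expect]
    rw [expect_comm]
    exact expect_congr rfl fun a _ => expect_comm _ _ _
  have h2 : (𝔼 a : ι → ℤˣ, 𝔼 a' : ι → ℤˣ, 𝔼 b : ι → ℤˣ,
      F (I.piecewise a b) * F (I.piecewise a' b)) ^ 2 ≤
      𝔼 a : ι → ℤˣ, 𝔼 a' : ι → ℤˣ, (𝔼 b : ι → ℤˣ,
        F (I.piecewise a b) * F (I.piecewise a' b)) ^ 2 :=
    (sq_expect_le _).trans (expect_mono fun a => sq_expect_le _)
  calc (𝔼 x, F x) ^ 4 = ((𝔼 x, F x) ^ 2) ^ 2 := by ring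
    _ ≤ _ := pow_le_pow_left₀ (sq_nonneg _) h1 2
    _ ≤ _ := h2
    _ = _ := by
      refine expect_congr rfl fun a _ => expect_congr rfl fun a' _ => ?_
      rw [sq_expect, expect_comm]

lemma expect_ind_eqOn_le (a' : ι → ℤˣ) (I : Finset ι) :
    𝔼 a : ι → ℤˣ, ind (∀ i ∈ I, a i = a' i) ≤ (1 / 2) ^ #I := by
  induction I using Finset.induction_on with
  | empty => simp [ind, expect_const univ_nonempty]
  | insert i I hi ih =>
    set H : (ι → ℤˣ) → ℝ := fun a => ind (∀ j ∈ insert i I, a j = a' j)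
    set g : ι → ℤˣ := Pi.mulSingle i (-1)
    have hsym : 𝔼 a, H a = 𝔼 a, (H a + H (g * a)) / 2 := by
      rw [← expect_div, expect_add_distrib, expect_comp_mul_left]; ring
    have hpt : ∀ a, (H a + H (g * a)) / 2 ≤ ind (∀ j ∈ I, a j = a' j) / 2 := by
      intro a
      have hI : (∀ j ∈ I, (g * a) j = a' j) ↔ ∀ j ∈ I, a j = a' j :=
        forall₂_congr fun j hj => by
          have : j ≠ i := fun h => hi (h ▸ hj)
          simp [g, Pi.mulSingle_eq_of_ne this]
      have hgi : (g * a) i = -a i := by simp [g]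
      simp only [H, forall_mem_insert, ind_and, hI, hgi]
      rw [← add_mul]
      refine div_le_div_of_nonneg_right (mul_le_of_le_one_left (ind_nonneg _) ?_) (by norm_num)
      by_cases h : a i = a' i
      · rw [ind_of_true h, ind_of_false fun h' => units_ne_neg_self _ (h.trans h'.symm)]
        norm_num
      · rw [ind_of_false h, zero_add]
        exact ind_le_one _
    rw [hsym, card_insert_of_notMem hi, pow_succ]
    refine (expect_mono hpt).trans ?_
    rw [← expect_div]
    linarith

end Decoupling

section Border

variable {ι : Type*} [Fintype ι] [DecidableEq ι]

lemma sym2_option_bijective {ι : Type*} : Function.Bijective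
    (Sum.elim (Sym2.map some) fun o => s(none, o) : Sym2 ι ⊕ Option ι → Sym2 (Option ι)) := by
  constructor
  · rintro (e | o) (e' | o') h
    · exact congrArg _ (Sym2.map.injective (Option.some_injective ι) h)
    · induction e with | _ i j => simp at h
    · induction e' with | _ i j => simp at h
    · exact congrArg _ (Sym2.congr_right.1 h)
  · intro e
    induction e with
    | _ a b =>
      cases a with
      | none => exact ⟨Sum.inr b, rfl⟩
      | some i =>
        cases b with
        | none => exact ⟨Sum.inr (some i), Sym2.eq_swap⟩
        | some j => exact ⟨Sum.inl s(i, j), rfl⟩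

/-- A uniform sign pattern on `Option ι` consists of independent uniform sign patterns for the
principal block, the corner and the border. -/
lemma expect_border (G : (Sym2 ι → ℤˣ) → ℤˣ → (ι → ℤˣ) → ℝ) :
    𝔼 f : Sym2 (Option ι) → ℤˣ,
      G (fun e => f (e.map some)) (f s(none, none)) (fun i => f s(none, some i)) =
      𝔼 c, 𝔼 x, 𝔼 g, G g c x := by
  let e : (Sym2 (Option ι) → ℤˣ) ≃ (ℤˣ × (ι → ℤˣ)) × (Sym2 ι → ℤˣ) :=
    ((Equiv.ofBijective _ sym2_option_bijective).arrowCongr (Equiv.refl ℤˣ)).symm.trans <|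
      (Equiv.sumArrowEquivProdArrow _ _ _).trans <| (Equiv.prodComm _ _).trans <|
        (Equiv.piOptionEquivProd (β := fun _ => ℤˣ)).prodCongr (Equiv.refl _)
  rw [← expect_product', univ_product_univ, ← expect_product', univ_product_univ]
  exact Fintype.expect_equiv e _ _ fun f => rfl

end Border

section Quadratic

variable {p : ℕ} [Fact p.Prime] {ι : Type*} [Fintype ι] [DecidableEq ι]

/-- A sign vector restricted to `I`, with entries in `ℤ/pℤ`. -/
def signVec (p : ℕ) (I : Finset ι) (x : ι → ℤˣ) : ι → ZMod p :=
  fun i => if i ∈ I then ((x i : ℤ) : ZMod p) else 0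

lemma signVec_dotProduct (I : Finset ι) (x : ι → ℤˣ) (y : ι → ZMod p) :
    signVec p I x ⬝ᵥ y = ∑ i ∈ I, ((x i : ℤ) : ZMod p) * y i := by
  simp [signVec, dotProduct, ite_mul]

lemma signVec_univ_piecewise (I : Finset ι) (a b : ι → ℤˣ) :
    signVec p univ (I.piecewise a b) = signVec p I a + signVec p Iᶜ b := by
  ext i
  by_cases hi : i ∈ I <;> simp [signVec, hi]

lemma intCast_units_injective (hp : p ≠ 2) {s t : ℤˣ}
    (h : ((s : ℤ) : ZMod p) = ((t : ℤ) : ZMod p)) :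
    s = t := by
  have h2 := two_ne_zero_of_ne_two hp
  have h3 : (1 : ZMod p) ≠ -1 := fun h => h2 (by linear_combination h)
  rcases Int.units_eq_one_or s with rfl | rfl <;> rcases Int.units_eq_one_or t with rfl | rfl <;>
    simp_all [eq_comm]

lemma dotProduct_mulVec_comm {ι R : Type*} [Fintype ι] [CommRing R]
    {B : Matrix ι ι R} (hB : B.IsSymm)
    (x y : ι → R) : x ⬝ᵥ (B *ᵥ y) = y ⬝ᵥ (B *ᵥ x) := by
  rw [Matrix.dotProduct_mulVec, ← Matrix.mulVec_transpose, hB.eq, dotProduct_comm]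

lemma two_mul_dotProduct_eq_zero {ι R : Type*} [Fintype ι] [CommRing R]
    {B : Matrix ι ι R} (hB : B.IsSymm)
    {x x' y y' : ι → R} {c : R} (h1 : (x + y) ⬝ᵥ (B *ᵥ (x + y)) = c)
    (h2 : (x' + y) ⬝ᵥ (B *ᵥ (x' + y)) = c) (h3 : (x + y') ⬝ᵥ (B *ᵥ (x + y')) = c)
    (h4 : (x' + y') ⬝ᵥ (B *ᵥ (x' + y')) = c) :
    2 * (y ⬝ᵥ (B *ᵥ (x - x')) - y' ⬝ᵥ (B *ᵥ (x - x'))) = 0 := by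
  simp only [Matrix.mulVec_add, Matrix.mulVec_sub, dotProduct_add, add_dotProduct,
    dotProduct_sub] at *
  rw [dotProduct_mulVec_comm hB x y] at h1
  rw [dotProduct_mulVec_comm hB x' y] at h2
  rw [dotProduct_mulVec_comm hB x y'] at h3
  rw [dotProduct_mulVec_comm hB x' y'] at h4
  linear_combination h1 - h2 - h3 + h4

lemma isSymm_signMatrix {p : ℕ} {ι : Type*} (f : Sym2 ι → ℤˣ) : (signMatrix p f).IsSymm := by
  ext i j
  simp [signMatrix, Sym2.eq_swap]

/-- The inverse quadratic form of an invertible sign matrix takes the value `c` at `x`. -/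
def QuadraticHit (p : ℕ) [Fact p.Prime] (c : ZMod p) (g : Sym2 ι → ℤˣ) (x : ι → ℤˣ) : Prop :=
  IsUnit (signMatrix p g).det ∧
    signVec p univ x ⬝ᵥ ((signMatrix p g)⁻¹ *ᵥ signVec p univ x) = c

lemma expect_quadraticHit_prod_le (hp : p ≠ 2) (c : ZMod p) (I : Finset ι) {a a' : ι → ℤˣ}
    (haa' : ¬∀ i ∈ I, a i = a' i) (g : Sym2 ι → ℤˣ) :
    𝔼 b' : ι → ℤˣ, 𝔼 b : ι → ℤˣ,
      ind (QuadraticHit p c g (I.piecewise a b)) * ind (QuadraticHit p c g (I.piecewise a' b)) *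
        (ind (QuadraticHit p c g (I.piecewise a b')) *
          ind (QuadraticHit p c g (I.piecewise a' b'))) ≤
      ∑ v : ι → ZMod p, ind (Structured v) *
        ind (signMatrix p g *ᵥ v = signVec p I a - signVec p I a') + 2 ^ #I * (2 / p) := by
  have hp0 := prime_cast_pos (p := p)
  simp_rw [← ind_and]
  set M := signMatrix p g
  set w := signVec p I a - signVec p I a' with hw
  have hS : 0 ≤ ∑ v : ι → ZMod p, ind (Structured v ∧ M *ᵥ v = w) :=
    sum_nonneg fun v _ => ind_nonneg _
  by_cases hdet : IsUnit M.det
  swap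
  · rw [expect_eq_zero fun b' _ => expect_eq_zero fun b _ => ind_of_false fun h => hdet h.1.1.1]
    positivity
  set y := M⁻¹ *ᵥ w with hy
  have hMy : M *ᵥ y = w := by
    rw [hy, Matrix.mulVec_mulVec, Matrix.mul_nonsing_inv _ hdet, Matrix.one_mulVec]
  have hy0 : y ≠ 0 := fun h => haa' fun i hi => by
    have : w i = 0 := by rw [← hMy, h, Matrix.mulVec_zero, Pi.zero_apply]
    simp only [hw, signVec, Pi.sub_apply, if_pos hi] at this
    exact intCast_units_injective hp (sub_eq_zero.1 this)
  by_cases hst : Structured y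
  · refine le_add_of_le_of_nonneg ?_ (by positivity)
    refine le_trans ?_ (single_le_sum (fun v _ => ind_nonneg _) (mem_univ y))
    rw [ind_of_true ⟨hst, hMy⟩]
    refine (expect_mono fun b' => (expect_mono fun b => ind_le_one _).trans
      (expect_const univ_nonempty _).le).trans (expect_const univ_nonempty _).le
  · refine le_add_of_nonneg_of_le hS ?_
    have hret : returnProb y univ ≤ 2 / p := by
      by_contra! h
      exact hst ⟨hy0, h.le⟩
    refine (expect_mono fun b' => ?_).trans (expect_const univ_nonempty _).le
    refine (expect_mono fun b => ind_mono fun h => ?_).trans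
      ((expect_signed_sum_eq_le hp y Iᶜ (∑ j ∈ Iᶜ, ((b' j : ℤ) : ZMod p) * y j)).trans ?_)
    · obtain ⟨⟨⟨-, h1⟩, -, h2⟩, ⟨-, h3⟩, -, h4⟩ := h
      rw [signVec_univ_piecewise] at h1 h2 h3 h4
      have hB : (M⁻¹).IsSymm := (isSymm_signMatrix g).inv
      have := two_mul_dotProduct_eq_zero hB h1 h2 h3 h4
      rw [← signVec_dotProduct, ← signVec_dotProduct]
      exact sub_eq_zero.1 ((mul_eq_zero.1 this).resolve_left (two_ne_zero_of_ne_two hp))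
    · refine (returnProb_le_two_pow_mul_union y (disjoint_compl_right (a := I))).trans ?_
      rw [union_compl]
      gcongr

lemma expect_quadraticHit_le (hp : p ≠ 2) {Q δ : ℝ}
    (hQ : ∀ w : ι → ZMod p, ∑ v : ι → ZMod p, ind (Structured v) *
      𝔼 g : Sym2 ι → ℤˣ, ind (signMatrix p g *ᵥ v = w) ≤ Q)
    (I : Finset ι) (c : ZMod p) (hδ : 0 ≤ δ)
    (h : (1 / 2) ^ #I + (Q + 2 ^ #I * (2 / p)) ≤ δ ^ 4) :
    𝔼 x : ι → ℤˣ, 𝔼 g : Sym2 ι → ℤˣ, ind (QuadraticHit p c g x) ≤ δ := by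
  have hp0 := prime_cast_pos (p := p)
  have hQ0 : 0 ≤ Q := le_trans (sum_nonneg fun v _ => mul_nonneg (ind_nonneg _)
    (expect_nonneg fun _ _ => ind_nonneg _)) (hQ 0)
  rw [expect_comm]
  refine le_of_pow_le_pow_left₀ (n := 4) (by norm_num) hδ (le_trans ?_ h)
  calc (𝔼 g : Sym2 ι → ℤˣ, 𝔼 x : ι → ℤˣ, ind (QuadraticHit p c g x)) ^ 4
      ≤ 𝔼 g : Sym2 ι → ℤˣ, (𝔼 x : ι → ℤˣ, ind (QuadraticHit p c g x)) ^ 4 := by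
        have h1 := pow_le_pow_left₀ (sq_nonneg _)
          (sq_expect_le fun g : Sym2 ι → ℤˣ => 𝔼 x : ι → ℤˣ, ind (QuadraticHit p c g x)) 2
        have h2 := sq_expect_le fun g : Sym2 ι → ℤˣ =>
          (𝔼 x : ι → ℤˣ, ind (QuadraticHit p c g x)) ^ 2
        simp_rw [← pow_mul] at h1 h2
        exact h1.trans h2
    _ ≤ _ := expect_mono fun g => expect_pow_four_le I _
    _ = 𝔼 a : ι → ℤˣ, 𝔼 a' : ι → ℤˣ, 𝔼 g : Sym2 ι → ℤˣ, 𝔼 b' : ι → ℤˣ, 𝔼 b : ι → ℤˣ,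
      ind (QuadraticHit p c g (I.piecewise a b)) * ind (QuadraticHit p c g (I.piecewise a' b)) *
        (ind (QuadraticHit p c g (I.piecewise a b')) *
          ind (QuadraticHit p c g (I.piecewise a' b'))) := by
        rw [expect_comm]
        exact expect_congr rfl fun a _ => expect_comm _ _ _
    _ ≤ 𝔼 a : ι → ℤˣ, 𝔼 a' : ι → ℤˣ, (ind (∀ i ∈ I, a i = a' i) + (Q + 2 ^ #I * (2 / p))) := by
        refine expect_mono fun a => expect_mono fun a' => ?_
        by_cases haa' : ∀ i ∈ I, a i = a' i
        · rw [ind_of_true haa']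
          refine le_add_of_le_of_nonneg ?_ (by positivity)
          simp_rw [← ind_and]
          exact (expect_mono fun g => (expect_mono fun b' => (expect_mono fun b =>
            ind_le_one _).trans (expect_const univ_nonempty _).le).trans
              (expect_const univ_nonempty _).le).trans (expect_const univ_nonempty _).le
        · refine le_add_of_nonneg_of_le (ind_nonneg _) ?_
          refine (expect_mono fun g => expect_quadraticHit_prod_le hp c I haa' g).trans ?_
          rw [expect_add_distrib, expect_const univ_nonempty, expect_sum_comm]
          refine add_le_add_left ((sum_congr rfl fun v _ => ?_).trans_le
            (hQ (signVec p I a - signVec p I a'))) _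
          exact (mul_expect _ _ _).symm
    _ ≤ _ := by
        simp_rw [expect_add_distrib, expect_const univ_nonempty]
        refine add_le_add_left ?_ _
        rw [expect_comm]
        exact (expect_mono fun a' => expect_ind_eqOn_le a' I).trans
          (expect_const univ_nonempty _).le

end Quadratic

section Growth

variable {p : ℕ} [Fact p.Prime] {ι : Type*} [Fintype ι] [DecidableEq ι]

/-- Adding a row and a column decreases the corank of a singular matrix and preserves
nonsingularity, up to a small failure probability. -/
lemma expect_lt_corank_option_le (hp : p ≠ 2) {Q δ : ℝ}
    (hQ : ∀ w : ι → ZMod p, ∑ v : ι → ZMod p, ind (Structured v) *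
      𝔼 g : Sym2 ι → ℤˣ, ind (signMatrix p g *ᵥ v = w) ≤ Q)
    (I : Finset ι) (hδ : 0 ≤ δ) (h : (1 / 2) ^ #I + (Q + 2 ^ #I * (2 / p)) ≤ δ ^ 4) (j : ℕ) :
    𝔼 f : Sym2 (Option ι) → ℤˣ, ind (j < corank (signMatrix p f)) ≤
      𝔼 g : Sym2 ι → ℤˣ, ind (j + 1 < corank (signMatrix p g)) + (Q + 2 / p + δ) := by
  let P : (Sym2 ι → ℤˣ) → (ι → ZMod p) → Prop := fun g u =>
    u ≠ 0 ∧ ¬Structured u ∧ signMatrix p g *ᵥ u = 0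
  have hex : ∀ g, ∃ v, (∃ u, P g u) → P g v := fun g => by
    by_cases h : ∃ u, P g u
    · exact ⟨h.choose, fun _ => h.choose_spec⟩
    · exact ⟨0, fun h' => (h h').elim⟩
  choose V hV using hex
  let G : (Sym2 ι → ℤˣ) → ℤˣ → (ι → ℤˣ) → ℝ := fun g c x =>
    ind (j + 1 < corank (signMatrix p g)) +
      (∑ v : ι → ZMod p, ind (Structured v) * ind (signMatrix p g *ᵥ v = 0) +
        (ind (P g (V g) ∧ signVec p univ x ⬝ᵥ V g = 0) +
          ind (QuadraticHit p ((c : ℤ) : ZMod p) g x)))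
  have hpt : ∀ f : Sym2 (Option ι) → ℤˣ, ind (j < corank (signMatrix p f)) ≤
      G (fun e => f (e.map some)) (f s(none, none)) fun i => f s(none, some i) := by
    intro f
    set g : Sym2 ι → ℤˣ := fun e => f (e.map some) with hg
    set x : ι → ℤˣ := fun i => f s(none, some i) with hx
    have hN := isSymm_signMatrix (p := p) f
    have hM : (signMatrix p f).submatrix some some = signMatrix p g := by
      ext i k; simp [signMatrix, hg]
    have hxv : (fun i => signMatrix p f none (some i)) = signVec p univ x := by
      ext i; simp [signMatrix, signVec, hx]
    have hc : signMatrix p f none none = ((f s(none, none) : ℤ) : ZMod p) := rfl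
    have hsum : ind (∃ v : ι → ZMod p, Structured v ∧ signMatrix p g *ᵥ v = 0) ≤
        ∑ v : ι → ZMod p, ind (Structured v) * ind (signMatrix p g *ᵥ v = 0) := by
      by_cases hv : ∃ v : ι → ZMod p, Structured v ∧ signMatrix p g *ᵥ v = 0
      · rw [ind_of_true hv]
        obtain ⟨v, hv1, hv2⟩ := hv
        refine le_trans ?_ (single_le_sum
          (fun v _ => mul_nonneg (ind_nonneg _) (ind_nonneg _)) (mem_univ v))
        rw [ind_of_true hv1, ind_of_true hv2, mul_one]
      · rw [ind_of_false hv]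
        exact sum_nonneg fun v _ => mul_nonneg (ind_nonneg _) (ind_nonneg _)
    refine (ind_mono fun hj => ?_).trans ((ind_or_le _ _).trans (add_le_add le_rfl
      ((ind_or_le _ _).trans (add_le_add hsum (ind_or_le _ _)))))
    by_contra! hnot
    obtain ⟨hj1, hst, hP, hquad⟩ := hnot
    rcases Nat.eq_zero_or_pos (corank (signMatrix p g)) with h0 | hpos
    · have hdet : IsUnit (signMatrix p g).det := by
        rw [isUnit_iff_ne_zero]
        intro hd
        obtain ⟨v, hv, hMv⟩ := Matrix.exists_mulVec_eq_zero_iff.2 hd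
        exact (corank_pos_of_mulVec_eq_zero hv hMv).ne' h0
      have := corank_eq_zero_of_border hN (hM ▸ hdet) (by
        rw [hM, hxv, hc]
        exact fun h => hquad ⟨hdet, h⟩)
      omega
    · obtain ⟨u, hu, hMu⟩ := exists_mulVec_eq_zero_of_corank_pos hpos
      have hPV : P g (V g) := hV g ⟨u, hu, fun hs => hst u hs hMu, hMu⟩
      have := corank_lt_corank_submatrix hN (v := V g) (hM ▸ hPV.2.2) (hxv ▸ hP hPV)
      rw [hM] at this
      omega
  refine (expect_mono hpt).trans ((expect_border G).trans_le ?_)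
  simp_rw [G, expect_add_distrib, expect_const univ_nonempty]
  refine add_le_add le_rfl ?_
  rw [add_assoc]
  refine add_le_add ?_ (add_le_add ?_ ?_)
  · rw [expect_sum_comm]
    simp_rw [← mul_expect]
    exact hQ 0
  · rw [expect_comm]
    refine (expect_mono fun g => ?_).trans (expect_const univ_nonempty _).le
    by_cases hP : P g (V g)
    · refine (expect_mono fun x => ind_mono fun hx => ?_).trans
        ((expect_signed_sum_eq_le hp (V g) univ 0).trans ?_)
      · rw [← signVec_dotProduct]; exact hx.2
      · by_contra! hlt
        exact hP.2.1 ⟨hP.1, hlt.le⟩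
    · rw [expect_eq_zero fun x _ => ind_of_false fun hx => hP hx.1]
      have := prime_cast_pos (p := p)
      positivity
  · exact (expect_mono fun c => expect_quadraticHit_le hp hQ I _ hδ h).trans
      (expect_const univ_nonempty _).le

/-- The probability that the random symmetric sign matrix of size `m` over `ℤ/pℤ` has corank
larger than `j`. -/
noncomputable def corankProb (p m j : ℕ) [Fact p.Prime] : ℝ :=
  𝔼 f : Sym2 (Fin m) → ℤˣ, ind (j < corank (signMatrix p f))

lemma corankProb_le (hp : p ≠ 2) {Q δ : ℝ} {m : ℕ}
    (hQ : ∀ w : Fin m → ZMod p, ∑ v : Fin m → ZMod p, ind (Structured v) *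
      𝔼 g : Sym2 (Fin m) → ℤˣ, ind (signMatrix p g *ᵥ v = w) ≤ Q)
    {q : ℕ} (hq : q ≤ m) (hδ : 0 ≤ δ) (h : (1 / 2) ^ q + (Q + 2 ^ q * (2 / p)) ≤ δ ^ 4) (j : ℕ) :
    corankProb p (m + 1) j ≤ corankProb p m (j + 1) + (Q + 2 / p + δ) := by
  obtain ⟨I, -, hI⟩ := exists_subset_card_eq (s := (univ : Finset (Fin m))) (n := q) (by simpa)
  have h1 := expect_lt_corank_option_le hp hQ I hδ (hI ▸ h) j
  refine le_trans (le_of_eq ?_) h1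
  let e : (Sym2 (Fin (m + 1)) → ℤˣ) ≃ (Sym2 (Option (Fin m)) → ℤˣ) :=
    Equiv.arrowCongr ⟨Sym2.map (finSuccEquiv m), Sym2.map (finSuccEquiv m).symm,
      fun x => by simp [Sym2.map_map], fun x => by simp [Sym2.map_map]⟩ (Equiv.refl ℤˣ)
  refine Fintype.expect_equiv e _ _ fun f => ?_
  have : signMatrix p f =
      (signMatrix p (e f)).submatrix (finSuccEquiv m) (finSuccEquiv m) := by
    ext i k; simp [signMatrix, e]
  rw [this, corank_submatrix]

lemma corankProb_add_le {m : ℕ} {η : ℝ} (t : ℕ)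
    (h : ∀ k < t, ∀ j, corankProb p (m + k + 1) j ≤ corankProb p (m + k) (j + 1) + η) (j : ℕ) :
    corankProb p (m + t) j ≤ corankProb p m (j + t) + t * η := by
  induction t generalizing j with
  | zero => simp
  | succ t ih =>
    have h1 := h t (Nat.lt_succ_self t) j
    have h2 := ih (fun k hk => h k (hk.trans (Nat.lt_succ_self t))) (j + 1)
    rw [← add_assoc m, ← add_assoc j, add_right_comm j]
    push_cast
    linarith

lemma corankProb_eq_zero {m j : ℕ} (h : m ≤ j) : corankProb p m j = 0 :=
  expect_eq_zero fun f _ => ind_of_false fun hj => by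
    have := corank_le_card (signMatrix p f)
    rw [Fintype.card_fin] at this
    omega

end Growth

section Determinant

variable {n : ℕ}

lemma symPr_eq_expect (E : Set (Matrix (Fin n) (Fin n) ℤ)) :
    symPr n E = 𝔼 f : Sym2 (Fin n) → ℤˣ, ind (Matrix.of (fun i j => (f s(i, j) : ℤ)) ∈ E) := by
  let Φ : (Sym2 (Fin n) → ℤˣ) → Matrix (Fin n) (Fin n) ℤ := fun f =>
    Matrix.of fun i j => (f s(i, j) : ℤ)
  have hΦ : Function.Injective Φ := fun f g h => by
    ext e
    induction e with | _ i j => exact congrFun (congrFun h i) j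
  have hS : ∀ A : Matrix (Fin n) (Fin n) ℤ, (A.IsSymm ∧ ∀ i j, A i j = 1 ∨ A i j = -1) ↔
      A ∈ Set.range Φ := by
    intro A
    constructor
    · rintro ⟨hA, h⟩
      refine ⟨Sym2.lift ⟨fun i j => if A i j = 1 then 1 else -1, fun i j => by
        simp only [hA.apply i j]⟩, ?_⟩
      ext i j
      rcases h i j with h | h <;> simp [Φ, h]
    · rintro ⟨f, rfl⟩
      refine ⟨?_, fun i j => ?_⟩
      · ext i j; simp [Φ, Sym2.eq_swap]
      · rcases Int.units_eq_one_or (f s(i, j)) with h | h <;> simp [Φ, h]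
  have h1 : ∀ F : Set (Matrix (Fin n) (Fin n) ℤ),
      (Nat.card {A : Matrix (Fin n) (Fin n) ℤ |
        (A.IsSymm ∧ ∀ i j, A i j = 1 ∨ A i j = -1) ∧ A ∈ F} : ℝ) = ∑ f, ind (Φ f ∈ F) := by
    intro F
    have : {A : Matrix (Fin n) (Fin n) ℤ |
        (A.IsSymm ∧ ∀ i j, A i j = 1 ∨ A i j = -1) ∧ A ∈ F} = Φ '' {f | Φ f ∈ F} := by
      ext A
      simp only [Set.mem_ofPred_eq, hS]
      constructor
      · rintro ⟨⟨f, rfl⟩, hf⟩; exact ⟨f, hf, rfl⟩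
      · rintro ⟨f, hf, rfl⟩; exact ⟨⟨f, rfl⟩, hf⟩
    classical
    rw [this, Nat.card_image_of_injective hΦ, Nat.card_eq_fintype_card, Fintype.card_subtype]
    simp [ind]
  have h2 := h1 Set.univ
  simp only [Set.mem_univ, and_true] at h2
  rw [symPr, h1 E, h2, Fintype.expect_eq_sum_div_card]
  congr 1
  simp [ind]

lemma symPr_det_eq_zero_le (p : ℕ) [Fact p.Prime] :
    symPr n {A | A.det = 0} ≤ corankProb p n 0 := by
  rw [symPr_eq_expect]
  refine expect_mono fun f => ind_mono fun h => ?_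
  have hdet : (signMatrix p f).det = 0 := by
    have := congrArg (Int.castRingHom (ZMod p)) (show Matrix.det _ = 0 from h)
    rw [RingHom.map_det, map_zero] at this
    exact this
  obtain ⟨v, hv, hMv⟩ := Matrix.exists_mulVec_eq_zero_iff.2 hdet
  exact corank_pos_of_mulVec_eq_zero hv hMv

end Determinant

section Asymptotics

lemma sqrt_mul_log_bounds {n : ℕ} (hn : 10 ^ 10 ≤ Real.log n) :
    √(n * Real.log n) ^ 2 = n * Real.log n ∧ 10 ^ 4 * Real.log n ≤ √(n * Real.log n) ∧
      10 ^ 4 * (Real.exp (3 * Real.log n / 8) * √(n * Real.log n)) ≤ n := by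
  set u := Real.log n with hu
  have hn0 : (0 : ℝ) < n := by
    rcases Nat.eq_zero_or_pos n with h | h
    · rw [hu, h, Nat.cast_zero, Real.log_zero] at hn; norm_num at hn
    · exact_mod_cast h
  set y := Real.exp (u / 8) with hy
  have hpow : ∀ k : ℕ, y ^ k = Real.exp (k * (u / 8)) := fun k => (Real.exp_nat_mul _ _).symm
  have hny : (n : ℝ) = y ^ 8 := by
    rw [hpow, ← Real.exp_log hn0]; congr 1; push_cast; ring
  have hy3 : Real.exp (3 * u / 8) = y ^ 3 := by
    rw [hpow]; congr 1; push_cast; ring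
  have hyu : u / 8 ≤ y := by linarith [Real.add_one_le_exp (u / 8)]
  have hy1 : 1 ≤ y := by linarith
  have hy2 : 10 ^ 8 * u ≤ y ^ 2 := by nlinarith
  have hS0 : 0 ≤ √(n * u) := Real.sqrt_nonneg _
  have hS : √(n * u) ^ 2 = n * u := Real.sq_sqrt (by positivity)
  refine ⟨hS, ?_, ?_⟩
  · refine le_of_sq_le_sq ?_ hS0
    rw [hS, hny]
    have : y ^ 2 ≤ y ^ 8 := pow_le_pow_right₀ hy1 (by norm_num)
    nlinarith
  · have h1 : 10 ^ 4 * √(n * u) ≤ y ^ 5 := by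
      refine le_of_sq_le_sq ?_ (by positivity)
      rw [mul_pow, hS, hny]
      have : 0 ≤ y ^ 8 := by positivity
      nlinarith
    rw [hy3]
    calc 10 ^ 4 * (y ^ 3 * √(n * u)) = y ^ 3 * (10 ^ 4 * √(n * u)) := by ring
      _ ≤ y ^ 3 * y ^ 5 := by gcongr
      _ = n := by rw [hny]; ring

lemma pow_le_exp_mul {a c : ℝ} (ha : 0 ≤ a) (h : a ≤ Real.exp c) (k : ℕ) :
    a ^ k ≤ Real.exp (k * c) := by
  rw [Real.exp_nat_mul]
  exact pow_le_pow_left₀ ha h k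

lemma le_exp_natCast {a : ℝ} {k : ℕ} (h : a ≤ 2.718 ^ k) : a ≤ Real.exp k := by
  refine h.trans ?_
  rw [← mul_one (k : ℝ), Real.exp_nat_mul]
  exact pow_le_pow_left₀ (by norm_num) (by linarith [Real.exp_one_gt_d9]) k

/-- For a prime of size `exp (Θ(√(n log n)))`, structured vectors contribute at most `1 / p`. -/
lemma sum_structured_le_inv {n m p : ℕ} [Fact p.Prime] (hp : p ≠ 2) (hn : 10 ^ 10 ≤ Real.log n)
    (hpl : Real.log p ≤ √(n * Real.log n) / 50) (hp1 : 1 ≤ Real.log p)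
    (hm : n / 2 ≤ m) (hmn : m ≤ n) (w : Fin m → ZMod p) :
    ∑ v : Fin m → ZMod p, ind (Structured v) *
      𝔼 g : Sym2 (Fin m) → ℤˣ, ind (signMatrix p g *ᵥ v = w) ≤ 1 / p := by
  obtain ⟨hS2, hSu, hSn⟩ := sqrt_mul_log_bounds hn
  have hp0 := prime_cast_pos (p := p)
  have hpe : (p : ℝ) = Real.exp (Real.log p) := (Real.exp_log hp0).symm
  set S := √(n * Real.log n)
  set u := Real.log n
  set l := Real.log p
  have hS0 : 0 ≤ S := Real.sqrt_nonneg _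
  have he1 : 1 ≤ Real.exp (3 * u / 8) := Real.one_le_exp (by linarith)
  have hSn' : 10 ^ 4 * S ≤ n := le_trans (by nlinarith) hSn
  have hn1 : (10 : ℝ) ^ 10 ≤ n := by linarith
  have h78 : (7 / 8 : ℝ) ≤ Real.exp (-1 / 8) := by
    linarith [Real.add_one_le_exp (-1 / 8 : ℝ)]
  set D := ⌈8 * l⌉₊ + 1 with hDdef
  have hDl : 8 * l + 1 ≤ D := by
    rw [hDdef]; push_cast; linarith [Nat.le_ceil (8 * l)]
  have hDu : (D : ℝ) ≤ S / 5 := by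
    rw [hDdef]; push_cast; linarith [Nat.ceil_lt_add_one (show 0 ≤ 8 * l by linarith)]
  set r := ⌊u / 8⌋₊
  have hru : (r : ℝ) ≤ u / 8 := Nat.floor_le (by linarith)
  have hrl : u / 8 - 1 ≤ r := (Nat.sub_one_lt_floor _).le
  have h8r : (8 : ℝ) ^ r ≤ Real.exp (3 * u / 8) := by
    refine (pow_le_exp_mul (c := 3) (by norm_num)
      (le_exp_natCast (k := 3) (by norm_num)) r).trans (Real.exp_le_exp.2 (by linarith))
  have h40 : (40 : ℝ) / 2 ^ r ≤ Real.exp (5 - u / 16) := by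
    rw [div_le_iff₀ (by positivity)]
    have h2 : Real.exp (r / 2) ≤ 2 ^ r := by
      rw [div_eq_mul_one_div, Real.exp_nat_mul]
      refine pow_le_pow_left₀ (Real.exp_pos _).le ?_ r
      refine le_of_sq_le_sq ?_ (by norm_num)
      rw [← Real.exp_nat_mul]
      norm_num
      linarith [Real.exp_one_lt_d9]
    calc (40 : ℝ) ≤ Real.exp (4 : ℕ) := le_exp_natCast (by norm_num)
      _ ≤ Real.exp (5 - u / 16 + r / 2) := Real.exp_le_exp.2 (by push_cast; linarith)
      _ = Real.exp (5 - u / 16) * Real.exp (r / 2) := Real.exp_add _ _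
      _ ≤ _ := by gcongr
  set s := (8 ^ r + 1) * D with hs
  have hsn : 10 ^ 4 * (s : ℝ) ≤ n := by
    refine le_trans ?_ hSn
    rw [hs]; push_cast
    have : ((8 : ℝ) ^ r + 1) * D ≤ (2 * Real.exp (3 * u / 8)) * (S / 5) :=
      mul_le_mul (by linarith) hDu (by positivity) (by positivity)
    have : 0 ≤ Real.exp (3 * u / 8) * S := by positivity
    nlinarith
  set h := n / 3
  have hhl : (n : ℝ) / 4 ≤ h := by
    have : n ≤ 3 * h + 2 := by omega
    have : (n : ℝ) ≤ 3 * h + 2 := by exact_mod_cast this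
    linarith
  have hsh : s + h ≤ m := by
    have h1 : 10 ^ 4 * s ≤ n := by exact_mod_cast hsn
    have h2 : 10 ^ 10 ≤ n := by exact_mod_cast hn1
    omega
  have hmn' : (m : ℝ) ≤ n := by exact_mod_cast hmn
  have h78pow : ∀ k : ℕ, (p : ℝ) * (7 / 8) ^ k ≤ Real.exp (l - k / 8) := fun k => by
    rw [sub_eq_add_neg, Real.exp_add, ← hpe]
    gcongr
    refine (pow_le_exp_mul (by norm_num) h78 k).trans (Real.exp_le_exp.2 (by linarith))
  have hsum := sum_structured_le (ι := Fin m) (p := p) hp w (D := D) (h := h) (r := r) (s := s)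
    ((h78pow D).trans_lt (Real.exp_lt_one_iff.2 (by linarith))) le_rfl (by simpa using hsh)
    ((h78pow h).trans (Real.exp_le_one_iff.2 (by linarith)))
    (h40.trans (Real.exp_le_one_iff.2 (by linarith)))
  rw [Fintype.card_fin] at hsum
  have hsparse : p * (7 / 8 : ℝ) ^ h * 400 ^ s * (101 / 100) ^ m ≤ Real.exp (-l - 1) := by
    have h1 : (400 : ℝ) ^ s ≤ Real.exp (s * 7) :=
      pow_le_exp_mul (by norm_num) (le_exp_natCast (k := 7) (by norm_num)) s
    have h2 : (101 / 100 : ℝ) ^ m ≤ Real.exp (m * (1 / 100)) :=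
      pow_le_exp_mul (by norm_num) (by linarith [Real.add_one_le_exp (1 / 100 : ℝ)]) m
    calc p * (7 / 8 : ℝ) ^ h * 400 ^ s * (101 / 100) ^ m
        ≤ Real.exp (l - h / 8) * Real.exp (s * 7) * Real.exp (m * (1 / 100)) := by
          gcongr
          exact h78pow h
      _ = Real.exp (l - h / 8 + s * 7 + m * (1 / 100)) := by rw [Real.exp_add, Real.exp_add]
      _ ≤ _ := Real.exp_le_exp.2 (by linarith)
  have hdense : (p : ℝ) ^ D * 16 ^ m * (40 / 2 ^ r) ^ h ≤ Real.exp (-l - 1) := by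
    have h1 : (p : ℝ) ^ D ≤ Real.exp (D * l) := pow_le_exp_mul hp0.le hpe.le D
    have h2 : (16 : ℝ) ^ m ≤ Real.exp (m * 3) :=
      pow_le_exp_mul (by norm_num) (le_exp_natCast (k := 3) (by norm_num)) m
    have h3 := pow_le_exp_mul (by positivity) h40 h
    calc (p : ℝ) ^ D * 16 ^ m * (40 / 2 ^ r) ^ h
        ≤ Real.exp (D * l) * Real.exp (m * 3) * Real.exp (h * (5 - u / 16)) := by gcongr
      _ = Real.exp (D * l + m * 3 + h * (5 - u / 16)) := by rw [Real.exp_add, Real.exp_add]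
      _ ≤ _ := Real.exp_le_exp.2 (by
        have h4 : D * l ≤ n * u / 250 := by
          calc D * l ≤ S / 5 * (S / 50) := mul_le_mul hDu hpl (by linarith) (by linarith)
            _ = n * u / 250 := by rw [← hS2]; ring
        have h5 : h * (5 - u / 16) ≤ n / 4 * (5 - u / 16) :=
          mul_le_mul_of_nonpos_right hhl (by linarith)
        have h6 : n * 10 ^ 10 ≤ n * u := by gcongr
        linarith)
  refine hsum.trans ((add_le_add hsparse hdense).trans ?_)
  rw [Real.exp_sub, Real.exp_neg, ← hpe, one_div, ← two_mul, ← mul_div_assoc,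
    div_le_iff₀ (Real.exp_pos 1), mul_comm]
  gcongr
  linarith [Real.exp_one_gt_d9]

lemma exists_prime_log_bounds {S : ℝ} (hS : 10 ^ 4 ≤ S) :
    ∃ p : ℕ, p.Prime ∧ p ≠ 2 ∧ S / 100 ≤ Real.log p ∧ Real.log p ≤ S / 50 := by
  have he : 2 ≤ Real.exp (S / 100) := by linarith [Real.add_one_le_exp (S / 100)]
  have hceil := Nat.le_ceil (Real.exp (S / 100))
  have hceil' := Nat.ceil_lt_add_one (Real.exp_pos (S / 100)).le
  set k := ⌈Real.exp (S / 100)⌉₊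
  obtain ⟨p, hp, hkp, hpk⟩ := Nat.exists_prime_lt_and_le_two_mul k (by
    intro h; rw [h, Nat.cast_zero] at hceil; linarith)
  have h1 : (k : ℝ) < p := by exact_mod_cast hkp
  have h2 : (p : ℝ) ≤ 2 * k := by exact_mod_cast hpk
  have hp0 : (0 : ℝ) < p := by linarith
  refine ⟨p, hp, ?_, ?_, ?_⟩
  · rintro rfl
    have : (k : ℝ) ≤ 1 := by exact_mod_cast Nat.le_of_lt_succ hkp
    linarith
  · rw [Real.le_log_iff_exp_le hp0]; linarith
  · rw [Real.log_le_iff_le_exp hp0]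
    have h4 : (4 : ℝ) ≤ Real.exp (2 : ℕ) := le_exp_natCast (by norm_num)
    calc (p : ℝ) ≤ 4 * Real.exp (S / 100) := by linarith
      _ ≤ Real.exp (2 : ℕ) * Real.exp (S / 100) := by gcongr
      _ = Real.exp ((2 : ℕ) + S / 100) := (Real.exp_add _ _).symm
      _ ≤ _ := Real.exp_le_exp.2 (by push_cast; linarith)

/-- The unconditional singularity bound. -/
theorem symPr_det_eq_zero_le_exp {n : ℕ} (hn : 10 ^ 10 ≤ Real.log n) :
    symPr n {A | A.det = 0} ≤ Real.exp (-((2 : ℝ) ^ (-13 : ℤ)) * √(n * Real.log n)) := by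
  obtain ⟨-, hSu, hSn⟩ := sqrt_mul_log_bounds hn
  obtain ⟨p, hprime, hp2, hpl, hpu⟩ := exists_prime_log_bounds
    (S := √(n * Real.log n)) (by linarith)
  have : Fact p.Prime := ⟨hprime⟩
  have hp0 := prime_cast_pos (p := p)
  have hpe : (p : ℝ) = Real.exp (Real.log p) := (Real.exp_log hp0).symm
  set S := √(n * Real.log n)
  set u := Real.log n with hu
  set l := Real.log p
  have hn0 : (0 : ℝ) < n := by
    rcases Nat.eq_zero_or_pos n with h | h
    · rw [hu, h, Nat.cast_zero, Real.log_zero] at hn; norm_num at hn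
    · exact_mod_cast h
  have he1 : 1 ≤ Real.exp (3 * u / 8) := Real.one_le_exp (by linarith)
  have hSn' : 10 ^ 4 * S ≤ n := le_trans (by nlinarith) hSn
  have hl1 : 1 ≤ l := by linarith
  set q := Nat.log 4 p
  have hq1 : (4 : ℝ) ^ q ≤ p := by exact_mod_cast Nat.pow_log_le_self 4 hprime.ne_zero
  have hq2 : (p : ℝ) < 4 ^ (q + 1) := by exact_mod_cast Nat.lt_pow_succ_log_self (by norm_num) p
  set z := Real.exp (-l / 8) with hz
  have hz0 : 0 < z := Real.exp_pos _
  have hz1 : z ≤ 1 := Real.exp_le_one_iff.2 (by linarith)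
  have hzp : z ^ 8 = 1 / p := by
    rw [hz, ← Real.exp_nat_mul, hpe, one_div, ← Real.exp_neg]; congr 1; push_cast; ring
  have hqz1 : (2 : ℝ) ^ q * z ^ 4 ≤ 1 := by
    refine le_of_sq_le_sq ?_ zero_le_one
    rw [mul_pow, ← pow_mul, ← pow_mul, mul_comm q, pow_mul, hzp, mul_one_div, one_pow,
      div_le_one hp0]
    norm_num
    exact hq1
  have hqz2 : (1 / 2 : ℝ) ^ q ≤ 2 * z ^ 4 := by
    refine le_of_sq_le_sq ?_ (by positivity)
    rw [mul_pow, ← pow_mul, ← pow_mul, mul_comm q, pow_mul, hzp, one_div_pow, mul_one_div,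
      one_div_pow, div_le_div_iff₀ (by positivity) hp0]
    rw [pow_succ] at hq2
    norm_num
    linarith
  have hqn : q ≤ n / 2 := by
    have h1 : Real.exp q ≤ Real.exp l := by
      rw [← hpe, ← mul_one (q : ℝ), Real.exp_nat_mul]
      exact (pow_le_pow_left₀ (Real.exp_pos 1).le (by linarith [Real.exp_one_lt_d9]) q).trans hq1
    have h2 : 10 * (q : ℝ) ≤ n := by linarith [Real.exp_le_exp.1 h1]
    have h3 : 10 * q ≤ n := by exact_mod_cast h2
    omega
  have hδ : (1 / 2 : ℝ) ^ q + (1 / p + 2 ^ q * (2 / p)) ≤ (2 * z) ^ 4 := by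
    have h1 : 2 / (p : ℝ) = 2 * z ^ 8 := by rw [hzp]; ring
    have h2 : z ^ 8 ≤ z ^ 4 := pow_le_pow_of_le_one hz0.le hz1 (by norm_num)
    rw [h1, ← hzp]
    have h3 : 2 ^ q * (2 * z ^ 8) ≤ 2 * z ^ 4 := by
      calc 2 ^ q * (2 * z ^ 8) = (2 ^ q * z ^ 4) * (2 * z ^ 4) := by ring
        _ ≤ 1 * (2 * z ^ 4) := by gcongr
        _ = _ := one_mul _
    have h4 : (2 * z) ^ 4 = 16 * z ^ 4 := by ring
    have h5 : 0 < z ^ 4 := by positivity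
    linarith
  have hstep : ∀ k < n - n / 2, ∀ j, corankProb p (n / 2 + k + 1) j ≤
      corankProb p (n / 2 + k) (j + 1) + (1 / p + 2 / p + 2 * z) := fun k hk j =>
    corankProb_le hp2 (fun w => sum_structured_le_inv hp2 hn hpu hl1 (by omega) (by omega) w)
      (by omega : q ≤ n / 2 + k) (by positivity) hδ j
  have hgrow := corankProb_add_le (n - n / 2) hstep 0
  rw [corankProb_eq_zero (by omega : n / 2 ≤ 0 + (n - n / 2)), zero_add,
    Nat.add_sub_cancel' (Nat.div_le_self n 2)] at hgrow
  refine (symPr_det_eq_zero_le p).trans (hgrow.trans ?_)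
  have hη : 1 / p + 2 / p + 2 * z ≤ 5 * z := by
    have h1 : 2 / (p : ℝ) = 2 * z ^ 8 := by rw [hzp]; ring
    have h2 : z ^ 8 ≤ z := pow_le_of_le_one hz0.le hz1 (by norm_num)
    rw [h1, ← hzp]
    linarith
  have ht : ((n - n / 2 : ℕ) : ℝ) ≤ n := by exact_mod_cast Nat.sub_le n _
  have hz5 : (5 : ℝ) ≤ Real.exp (2 : ℕ) := le_exp_natCast (by norm_num)
  calc ((n - n / 2 : ℕ) : ℝ) * (1 / p + 2 / p + 2 * z) ≤ n * (5 * z) := by gcongr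
    _ ≤ Real.exp u * (Real.exp (2 : ℕ) * z) := by
      rw [hu, Real.exp_log hn0]; gcongr
    _ = Real.exp (u + ((2 : ℕ) + -l / 8)) := by rw [Real.exp_add, Real.exp_add]
    _ ≤ _ := Real.exp_le_exp.2 (by norm_num; linarith)

end Asymptotics

end SymmetricSign

open scoped Classical in
/-- **Lemma 1.4.** Let `c = 1/800`, `n` sufficiently large, and `p ≤ exp(c√(n log n))` prime.
If for every `β` with `n/(2p) ≤ β ≤ 2n/p` one has
`∑_{v ≠ 0, ρ(v) ≥ β} max_w P(M_n v = w) ≤ e^{-cn}`, then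
`P(det M_n = 0) ≤ exp(-c'√(n log n))` with `c' = 2⁻¹³`. Here `ρ = rho 1` corresponds to
i.i.d. uniform `±1` coefficients. -/
theorem singularity_reduction :
    ∃ N : ℕ, ∀ n : ℕ, N ≤ n → ∀ (p : ℕ) [Fact p.Prime],
      (p : ℝ) ≤ Real.exp ((1 / 800 : ℝ) * Real.sqrt (n * Real.log n)) →
      (∀ β : ℝ, (n : ℝ) / (2 * p) ≤ β → β ≤ 2 * n / p →
        ∑ v ∈ Finset.univ.filter fun v : Fin n → ZMod p => v ≠ 0 ∧ β ≤ rho 1 v,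
          ⨆ w : Fin n → ZMod p,
            symPr n {A | (A.map (Int.cast : ℤ → ZMod p)).mulVec v = w} ≤
          Real.exp (-(1 / 800 : ℝ) * n)) →
      symPr n {A | A.det = 0} ≤
        Real.exp (-((2 : ℝ) ^ (-13 : ℤ)) * Real.sqrt (n * Real.log n)) := by
  refine ⟨⌈Real.exp (10 ^ 10)⌉₊, fun n hn p _ _ _ => SymmetricSign.symPr_det_eq_zero_le_exp ?_⟩
  have h := Nat.ceil_le.1 hn
  exact (Real.le_log_iff_exp_le ((Real.exp_pos _).trans_le h)).2 h
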